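/- arXiv:2209.15630 — 5 statements merged into one kernel-verified Lean document; each statement's English description precedes it below -/
import Mathlib

section
/- Let 𝒜 and ℬ be additive categories each admitting small direct sums and small direct products, and let G : 𝒜 → ℬ be an additive functor that commutes with small direct products. If X is a pure-injective object of 𝒜, then G X is a pure-injective object of ℬ. -/
/-!
STATEMENT 0: Let 𝒜 and ℬ be additive categories each admitting small direct sums and
small direct products, and let `G : 𝒜 ⥤ ℬ` be an additive functor that commutes with small
direct products. If `X` is a pure-injective object of 𝒜, then `G X` is a pure-injective
object of ℬ.

An object `X` is pure-injective if for every small set `I` the summation morphism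
`X^{(I)} → X` factors through the canonical morphism `X^{(I)} → X^{I}`.
-/

open CategoryTheory Limits

universe w v₁ v₂ u₁ u₂

open Classical in
/-- The canonical morphism from the coproduct of `I` copies of `X` to the product of `I`
copies of `X`, whose `(i,j)`-component is the identity if `i = j` and `0` otherwise. -/
noncomputable def coprodToProd {C : Type u₁} [Category.{v₁} C] [Preadditive C]
    [HasCoproducts.{w} C] [HasProducts.{w} C] (X : C) (I : Type w) :
    (∐ fun _ : I => X) ⟶ (∏ᶜ fun _ : I => X) :=
  Sigma.desc fun i => Pi.lift fun j => if i = j then 𝟙 X else 0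

/-- An object `X` of an additive category with small direct sums and small direct products is
pure-injective if for every small set `I` the summation morphism `X^{(I)} → X` factors through
the canonical morphism `X^{(I)} → X^{I}`. -/
def IsPureInjectiveObj {C : Type u₁} [Category.{v₁} C] [Preadditive C]
    [HasCoproducts.{w} C] [HasProducts.{w} C] (X : C) : Prop :=
  ∀ I : Type w, ∃ t : (∏ᶜ fun _ : I => X) ⟶ X,
    coprodToProd.{w} X I ≫ t = Sigma.desc fun _ : I => 𝟙 X

lemma ι_coprodToProd_map_piComparison {A : Type u₁} {B : Type u₂} [Category.{v₁} A]
    [Category.{v₂} B] [Preadditive A] [Preadditive B]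
    [HasCoproducts.{w} A] [HasProducts.{w} A] [HasCoproducts.{w} B] [HasProducts.{w} B]
    (G : A ⥤ B) [G.Additive] (X : A) (I : Type w) (i : I) :
    G.map (Sigma.ι (fun _ : I => X) i ≫ coprodToProd.{w} X I) ≫ piComparison G (fun _ : I => X) =
      Sigma.ι (fun _ : I => G.obj X) i ≫ coprodToProd.{w} (G.obj X) I := by
  refine Pi.hom_ext _ _ fun j => ?_
  rw [Category.assoc, piComparison_comp_π, ← G.map_comp]
  by_cases h : i = j <;> simp [coprodToProd, h]

theorem pureInjective_of_preservesProducts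
    {𝒜 : Type u₁} {ℬ : Type u₂} [Category.{v₁} 𝒜] [Category.{v₂} ℬ]
    [Preadditive 𝒜] [Preadditive ℬ]
    [HasCoproducts.{w} 𝒜] [HasProducts.{w} 𝒜] [HasCoproducts.{w} ℬ] [HasProducts.{w} ℬ]
    (G : 𝒜 ⥤ ℬ) [G.Additive]
    (hG : ∀ I : Type w, PreservesLimitsOfShape (Discrete I) G)
    (X : 𝒜) (hX : IsPureInjectiveObj.{w} X) :
    IsPureInjectiveObj.{w} (G.obj X) := by
  intro I
  obtain ⟨t, ht⟩ := hX I
  have := hG I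
  refine ⟨inv (piComparison G fun _ : I => X) ≫ G.map t, Sigma.hom_ext _ _ fun i => ?_⟩
  rw [← Category.assoc, ← ι_coprodToProd_map_piComparison, Category.assoc,
    IsIso.hom_inv_id_assoc, ← G.map_comp, Category.assoc, ht]
  simp
end

section
/- Let 𝒜 and ℬ be additive categories each admitting small direct sums and small direct products, and let G : 𝒜 → ℬ be an additive functor that is right adjoint to some additive functor ℬ → 𝒜. If X is a pure-injective object of 𝒜, then G X is a pure-injective object of ℬ. -/
/-!
STATEMENT 1: Let 𝒜 and ℬ be additive categories each admitting small direct sums and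
small direct products, and let `G : 𝒜 ⥤ ℬ` be an additive functor that is right adjoint to
some additive functor `ℬ ⥤ 𝒜`. If `X` is a pure-injective object of 𝒜, then `G X` is a
pure-injective object of ℬ.
-/

open CategoryTheory Limits

universe w v₁ v₂ u₁ u₂

open Classical in
lemma ι_coprodToProd_π {C : Type u₁} [Category.{v₁} C] [Preadditive C]
    [HasCoproducts.{w} C] [HasProducts.{w} C] (X : C) {I : Type w} (i j : I) :
    Sigma.ι (fun _ : I => X) i ≫ coprodToProd X I ≫ Pi.π (fun _ : I => X) j =
      if i = j then 𝟙 X else 0 := by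
  simp [coprodToProd]

/-- An additive functor carries the inclusions of the summands of `X^{(I)}` into `X^{I}` to those
of its value at `X`, up to the comparison morphism of products. -/
lemma map_ι_coprodToProd_piComparison {𝒜 : Type u₁} {ℬ : Type u₂}
    [Category.{v₁} 𝒜] [Category.{v₂} ℬ] [Preadditive 𝒜] [Preadditive ℬ]
    [HasCoproducts.{w} 𝒜] [HasProducts.{w} 𝒜] [HasCoproducts.{w} ℬ] [HasProducts.{w} ℬ]
    (G : 𝒜 ⥤ ℬ) [G.Additive] (X : 𝒜) {I : Type w} (i : I) :
    G.map (Sigma.ι (fun _ : I => X) i ≫ coprodToProd X I) ≫ piComparison G (fun _ : I => X) =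
      Sigma.ι (fun _ : I => G.obj X) i ≫ coprodToProd (G.obj X) I := by
  classical
  refine Pi.hom_ext _ _ fun j => ?_
  rw [Category.assoc, Category.assoc, piComparison_comp_π, ← G.map_comp, Category.assoc,
    ι_coprodToProd_π, ι_coprodToProd_π]
  split_ifs <;> simp

theorem pureInjective_of_rightAdjoint
    {𝒜 : Type u₁} {ℬ : Type u₂} [Category.{v₁} 𝒜] [Category.{v₂} ℬ]
    [Preadditive 𝒜] [Preadditive ℬ]
    [HasCoproducts.{w} 𝒜] [HasProducts.{w} 𝒜] [HasCoproducts.{w} ℬ] [HasProducts.{w} ℬ]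
    (G : 𝒜 ⥤ ℬ) [G.Additive]
    (F : ℬ ⥤ 𝒜) [F.Additive] (adj : F ⊣ G)
    (X : 𝒜) (hX : IsPureInjectiveObj.{w} X) :
    IsPureInjectiveObj.{w} (G.obj X) := by
  intro I
  obtain ⟨t, ht⟩ := hX I
  have : PreservesLimitsOfShape (Discrete I) G :=
    (adj.rightAdjoint_preservesLimits).preservesLimitsOfShape
  refine ⟨inv (piComparison G fun _ : I => X) ≫ G.map t, Sigma.hom_ext _ _ fun i => ?_⟩
  rw [← Category.assoc, ← map_ι_coprodToProd_piComparison]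
  rw [Category.assoc, IsIso.hom_inv_id_assoc, ← G.map_comp, Category.assoc, ht]
  simp
end

section
/- Let R be a commutative noetherian local ring and A a Noether R-algebra. Let M be a nonzero finitely generated right A-module, and assume that Ext^n_A(A/rad A, M) = 0 for some natural number n with n ≥ dim R, where dim R is the Krull dimension of R. Then the injective dimension of M as a right A-module is at most n − 1. -/
open CategoryTheory

universe u

/-- The Jacobson radical `rad A` (the intersection of the maximal left ideals of `A`,
a two-sided ideal), viewed as a submodule of the right regular module `A`
(formalized as the left regular `Aᵐᵒᵖ`-module). -/
def radRight (A : Type u) [Ring A] : Submodule Aᵐᵒᵖ Aᵐᵒᵖ where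
  carrier := {x | x.unop ∈ TwoSidedIdeal.jacobson (⊥ : TwoSidedIdeal A)}
  add_mem' := by
    intro x y hx hy
    simp only [Set.mem_setOf_eq, MulOpposite.unop_add] at *
    exact TwoSidedIdeal.add_mem _ hx hy
  zero_mem' := by
    simp only [Set.mem_setOf_eq, MulOpposite.unop_zero]
    exact TwoSidedIdeal.zero_mem _
  smul_mem' := by
    intro c x hx
    simp only [Set.mem_setOf_eq] at *
    exact (TwoSidedIdeal.jacobson (⊥ : TwoSidedIdeal A)).mul_mem_right _ _ hx

/-- `A/rad A`, regarded as a right `A`-module (i.e. a left `Aᵐᵒᵖ`-module). -/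
abbrev modRad (A : Type u) [Ring A] := Aᵐᵒᵖ ⧸ radRight A

/-- `Ext^n` in the category of modules over a ring `B`; taking `B = Aᵐᵒᵖ` gives the
Ext groups of right `A`-modules. -/
noncomputable abbrev extGrp (B : Type u) [Ring B] (n : ℕ) (X Y : ModuleCat.{u} B) :
    ModuleCat ℤ :=
  ((Ext ℤ (ModuleCat.{u} B) n).obj (Opposite.op X)).obj Y

/-- A module `M` has injective dimension `≤ d` iff `Ext^i(N, M) = 0` for all `i > d` and all
modules `N` (the standard characterization, equivalent to the existence of an injective
resolution of length `d`). -/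
def hasInjDimLE (B : Type u) [Ring B] (d : ℕ) (M : ModuleCat.{u} B) : Prop :=
  ∀ i : ℕ, d < i → ∀ N : ModuleCat.{u} B, Subsingleton (extGrp B i N M)

section ClassicalExt

open Opposite

variable {R : Type*} [Ring R] {C : Type*} [Category* C] [Abelian C] [Linear R C]
  [EnoughProjectives C]

lemma subsingleton_classicalExt_iff {X Y : C} (P : ProjectiveResolution X) (n : ℕ) :
    Subsingleton (((Ext R C n).obj (op X)).obj Y) ↔
      ∀ f : P.complex.X n ⟶ Y, P.complex.d (n + 1) n ≫ f = 0 →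
        ∃ g : P.complex.X ((ComplexShape.up ℕ).prev n) ⟶ Y,
          P.complex.d n ((ComplexShape.up ℕ).prev n) ≫ g = f := by
  rw [← ModuleCat.isZero_iff_subsingleton, (P.isoExt (R := R) n Y).isZero_iff,
    ← HomologicalComplex.exactAt_iff_isZero_homology,
    HomologicalComplex.exactAt_iff' _ _ n (n + 1) rfl (by simp),
    ShortComplex.moduleCat_exact_iff]
  rfl

lemma subsingleton_ext_of_classicalExt [HasExt C] {X Y : C} {n : ℕ}
    (h : Subsingleton (((Ext R C n).obj (op X)).obj Y)) :
    Subsingleton (Abelian.Ext X Y n) := by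
  let P := projectiveResolution X
  rw [subsingleton_classicalExt_iff P] at h
  refine subsingleton_of_forall_eq 0 fun α ↦ ?_
  obtain ⟨f, hf, rfl⟩ := P.extMk_surjective α (n + 1) rfl
  have h' := h f hf
  cases n with
  | zero =>
    obtain ⟨g, hg⟩ := h'
    have : f = 0 := by
      rw [← hg, P.complex.shape _ _ (by simp), Limits.zero_comp]
    simp [this]
  | succ n =>
    rw [P.extMk_eq_zero_iff _ _ _ _ n rfl]
    have hp : (ComplexShape.up ℕ).prev (n + 1) = n := by simp
    rwa [hp] at h'

lemma subsingleton_classicalExt_of_ext [HasExt C] {X Y : C} {n : ℕ}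
    (h : Subsingleton (Abelian.Ext X Y (n + 1))) :
    Subsingleton (((Ext R C (n + 1)).obj (op X)).obj Y) := by
  let P := projectiveResolution X
  rw [subsingleton_classicalExt_iff P]
  intro f hf
  have hp : (ComplexShape.up ℕ).prev (n + 1) = n := by simp
  rw [hp]
  exact (P.extMk_eq_zero_iff f (n + 2) rfl hf n rfl).1 (Subsingleton.elim _ _)

end ClassicalExt

section ExtVanishing

variable {B : Type u} [Ring B]

lemma LinearMap.shortExact_mk_ofHom {X Y Z : Type u} [AddCommGroup X] [AddCommGroup Y]
    [AddCommGroup Z] [Module B X] [Module B Y] [Module B Z] {f : X →ₗ[B] Y} {g : Y →ₗ[B] Z}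
    (hfg : Function.Exact f g) (hf : Function.Injective f) (hg : Function.Surjective g) :
    (ShortComplex.mk (ModuleCat.ofHom f) (ModuleCat.ofHom g)
      (by ext x; simpa using hfg.apply_apply_eq_zero x)).ShortExact :=
  ModuleCat.shortComplex_shortExact _ hfg hf hg

lemma CategoryTheory.ShortComplex.ShortExact.subsingleton_ext_X₂ {C : Type*} [Category* C]
    [Abelian C] [HasExt C] {S : ShortComplex C} (hS : S.ShortExact) {M : C} {n : ℕ}
    (h₁ : Subsingleton (Abelian.Ext S.X₁ M n)) (h₃ : Subsingleton (Abelian.Ext S.X₃ M n)) :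
    Subsingleton (Abelian.Ext S.X₂ M n) := by
  refine subsingleton_of_forall_eq 0 fun α ↦ ?_
  obtain ⟨β, rfl⟩ := Abelian.Ext.contravariant_sequence_exact₂ hS M α (Subsingleton.elim _ _)
  rw [Subsingleton.elim β 0, Abelian.Ext.comp_zero]

lemma CategoryTheory.Retract.subsingleton_ext {C : Type*} [Category* C]
    [Abelian C] [HasExt C] {X Y : C} (r : Retract X Y) {M : C} {n : ℕ}
    (h : Subsingleton (Abelian.Ext Y M n)) : Subsingleton (Abelian.Ext X M n) := by
  refine subsingleton_of_forall_eq 0 fun α ↦ ?_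
  rw [← Abelian.Ext.mk₀_id_comp α, ← r.retract, ← Abelian.Ext.mk₀_comp_mk₀_assoc,
    Subsingleton.elim ((Abelian.Ext.mk₀ r.r).comp α (zero_add n)) 0, Abelian.Ext.comp_zero]

lemma IsFiniteLength.subsingleton_ext {M : ModuleCat.{u} B} {n : ℕ}
    (h : ∀ (S : Type u) [AddCommGroup S] [Module B S] [IsSimpleModule B S],
      Subsingleton (Abelian.Ext (ModuleCat.of B S) M n))
    {L : Type u} [AddCommGroup L] [Module B L] (hL : IsFiniteLength B L) :
    Subsingleton (Abelian.Ext (ModuleCat.of B L) M n) := by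
  induction hL with
  | @of_subsingleton L _ _ _ =>
    have hz : Limits.IsZero (ModuleCat.of B L) := ModuleCat.isZero_of_subsingleton _
    refine subsingleton_of_forall_eq 0 fun α ↦ ?_
    rw [← Abelian.Ext.mk₀_id_comp α, hz.eq_zero_of_src (𝟙 _), Abelian.Ext.mk₀_zero,
      Abelian.Ext.zero_comp]
  | @of_simple_quotient L _ _ N _ _ ih =>
    exact (LinearMap.shortExact_mk_ofHom (f := N.subtype) (g := N.mkQ)
      (LinearMap.exact_subtype_mkQ N) N.injective_subtype N.mkQ_surjective).subsingleton_ext_X₂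
      ih (h _)

lemma hasInjectiveDimensionLT_of_ext_quotient_ideal {M : ModuleCat.{u} B} {n : ℕ}
    (h : ∀ J : Ideal B, Subsingleton (Abelian.Ext (ModuleCat.of B (B ⧸ J)) M (n + 1))) :
    HasInjectiveDimensionLT M (n + 1) := by
  induction n generalizing M with
  | zero =>
    rw [zero_add, ← injective_iff_hasInjectiveDimensionLT_one]
    refine (Module.injective_iff_injective_object B M).1 (Module.Baer.injective fun J g ↦ ?_)
    have hS := LinearMap.shortExact_mk_ofHom (f := J.subtype) (g := J.mkQ)
      (LinearMap.exact_subtype_mkQ J) J.injective_subtype J.mkQ_surjective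
    have := h J
    obtain ⟨φ, hφ⟩ := Abelian.Ext.contravariant_sequence_exact₁ hS M
      (Abelian.Ext.mk₀ (ModuleCat.ofHom g)) (zero_add 1) (Subsingleton.elim _ _)
    obtain ⟨φ, rfl⟩ := Abelian.Ext.homEquiv₀.symm.surjective φ
    rw [Abelian.Ext.homEquiv₀_symm_apply, Abelian.Ext.mk₀_comp_mk₀] at hφ
    have hφ' := (Abelian.Ext.mk₀_bijective _ _).1 hφ
    exact ⟨φ.hom, fun x hx ↦ congr(($hφ').hom ⟨x, hx⟩)⟩
  | succ n ih =>
    let p := (EnoughInjectives.presentation M).some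
    have hS := p.shortExact_shortComplex
    rw [← hS.hasInjectiveDimensionLT_X₃_iff n p.injective]
    refine ih fun J ↦ subsingleton_of_forall_eq 0 fun α ↦ ?_
    have := h J
    obtain ⟨β, rfl⟩ := Abelian.Ext.covariant_sequence_exact₃ _ hS α rfl (Subsingleton.elim _ _)
    have := p.injective
    rw [Abelian.Ext.eq_zero_of_injective (I := p.J) β, Abelian.Ext.zero_comp]

end ExtVanishing

section Torsion

variable {B : Type u} [Ring B]

lemma Module.Injective.exists_comp_eq_of_ker_le {X Y E : Type u} [AddCommGroup X] [AddCommGroup Y]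
    [AddCommGroup E] [Module B X] [Module B Y] [Module B E] [Module.Injective B E]
    (φ : X →ₗ[B] Y) (ψ : X →ₗ[B] E) (h : LinearMap.ker φ ≤ LinearMap.ker ψ) :
    ∃ g : Y →ₗ[B] E, g ∘ₗ φ = ψ := by
  obtain ⟨g, hg⟩ := Module.Injective.out ((LinearMap.ker φ).liftQ φ le_rfl)
    (LinearMap.ker_eq_bot.1 (Submodule.ker_liftQ_eq_bot' _ _ rfl)) ((LinearMap.ker φ).liftQ ψ h)
  exact ⟨g, LinearMap.ext fun x ↦ by simpa using hg (Submodule.Quotient.mk x)⟩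

variable {R : Type*} [CommRing R] [Algebra R B]

/-- Up to torsion, every element of an injective module over a noetherian algebra is divisible by
a central element, without enlarging its annihilator in the base ring. -/
lemma Module.Injective.exists_pow_smul_eq [IsNoetherianRing B] {E : Type u} [AddCommGroup E]
    [Module B E] [Module.Injective B E] (x : R) (w : E) :
    ∃ (b : ℕ) (w' : E), (∀ r : R, algebraMap R B r • w = 0 → algebraMap R B r • w' = 0) ∧
      algebraMap R B x ^ (b + 1) • w' = algebraMap R B x ^ b • w := by
  let K : Ideal B := Ideal.span {c | ∃ r : R, algebraMap R B r = c ∧ c • w = 0}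
  have hK : ∀ c ∈ K, c • w = 0 := by
    intro c hc
    induction hc using Submodule.span_induction with
    | mem c hc => obtain ⟨_, _, hc⟩ := hc; exact hc
    | zero => simp
    | add a b _ _ ha hb => rw [add_smul, ha, hb, add_zero]
    | smul a b _ hb => rw [smul_eq_mul, mul_smul, hb, smul_zero]
  let X := algebraMap R B x
  have hX : ∀ b : B, b * X = X * b := fun b ↦ (Algebra.commutes x b).symm
  have hXn : ∀ (n : ℕ) (b : B), b * X ^ n = X ^ n * b := fun n b ↦
    ((show Commute b X from hX b).pow_right n).eq
  let φ (n : ℕ) : B →ₗ[B] B ⧸ K := LinearMap.toSpanSingleton B _ (K.mkQ (X ^ n))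
  have hφ (n : ℕ) (b : B) : φ n b = 0 ↔ X ^ n * b ∈ K := by
    rw [LinearMap.toSpanSingleton_apply, ← map_smul, smul_eq_mul, hXn,
      ← LinearMap.mem_ker, Submodule.ker_mkQ]
  let T : ℕ →o Ideal B :=
    { toFun n := LinearMap.ker (φ n)
      monotone' := monotone_nat_of_le_succ fun n b hb ↦ by
        rw [LinearMap.mem_ker, hφ] at hb ⊢
        rw [pow_succ', mul_assoc]
        exact K.mul_mem_left _ hb }
  obtain ⟨n, hn⟩ := monotone_stabilizes_iff_noetherian.2 ‹IsNoetherianRing B› T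
  obtain ⟨g, hg⟩ := Module.Injective.exists_comp_eq_of_ker_le (φ (n + 1))
    (LinearMap.toSpanSingleton B E (X ^ n • w)) fun b hb ↦ by
      have hb : b ∈ T n := by rw [hn (n + 1) (by lia)]; exact hb
      have hb := (hφ n b).1 hb
      rw [LinearMap.mem_ker, LinearMap.toSpanSingleton_apply, ← mul_smul, hXn]
      exact hK _ hb
  refine ⟨n, g (K.mkQ 1), fun r hr ↦ ?_, ?_⟩
  · have h0 : K.mkQ (algebraMap R B r) = 0 :=
      (Submodule.Quotient.mk_eq_zero K).2 (Ideal.subset_span ⟨r, rfl, hr⟩)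
    rw [← map_smul, ← map_smul, smul_eq_mul, mul_one, h0, map_zero]
  · have := LinearMap.congr_fun hg 1
    simp only [LinearMap.comp_apply, LinearMap.toSpanSingleton_apply, one_smul, φ] at this
    rw [← this, ← map_smul, ← map_smul, smul_eq_mul, mul_one]

/-- The complex of sections of an injective resolution supported on the zero locus of a list of
`k` central elements is exact in degrees greater than `k`. -/
lemma exists_torsion_preimage_of_injective [IsNoetherianRing B] {E : ℕ → Type u}
    [∀ i, AddCommGroup (E i)] [∀ i, Module B (E i)] [∀ i, Module.Injective B (E i)]
    (d : ∀ i, E i →ₗ[B] E (i + 1)) (hd : ∀ i, Function.Exact (d i) (d (i + 1))) (l : List R)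
    (i : ℕ) (hi : l.length ≤ i) (z : E (i + 1)) (hz : d (i + 1) z = 0)
    (hl : ∀ x ∈ l, ∃ a : ℕ, algebraMap R B x ^ a • z = 0) :
    ∃ y : E i, d i y = z ∧ ∀ x ∈ l, ∃ a : ℕ, algebraMap R B x ^ a • y = 0 := by
  induction l generalizing i with
  | nil =>
    obtain ⟨y, hy⟩ := (hd i z).1 hz
    exact ⟨y, hy, by simp⟩
  | cons x l ih =>
    obtain ⟨i, rfl⟩ : ∃ j, i = j + 1 := ⟨i - 1, by simp at hi; lia⟩
    rw [List.length_cons, add_le_add_iff_right] at hi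
    obtain ⟨y, rfl, hy⟩ := ih (i + 1) (by lia) z hz fun x hx ↦ hl x (List.mem_cons_of_mem _ hx)
    obtain ⟨a, ha⟩ := hl x List.mem_cons_self
    have hcomm (r : R) (n m : ℕ) {j : ℕ} (e : E j) :
        algebraMap R B r ^ n • algebraMap R B x ^ m • e =
          algebraMap R B x ^ m • algebraMap R B r ^ n • e := by
      simp only [← mul_smul, ← map_pow, ← map_mul, mul_comm]
    obtain ⟨w, hw, hwl⟩ := ih i hi (algebraMap R B x ^ a • y) (by rw [map_smul, ha]) fun r hr ↦ by
      obtain ⟨c, hc⟩ := hy r hr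
      exact ⟨c, by rw [hcomm, hc, smul_zero]⟩
    obtain ⟨b, w', hw'l, hw'⟩ := Module.Injective.exists_pow_smul_eq (B := B) (x ^ a) w
    refine ⟨y - d i w', ?_, ?_⟩
    · rw [map_sub, (hd i).apply_apply_eq_zero, sub_zero]
    · intro r hr
      rcases List.mem_cons.1 hr with rfl | hr
      · refine ⟨a * (b + 1), ?_⟩
        rw [map_pow] at hw'
        rw [smul_sub, ← map_smul, pow_mul, hw', map_smul, hw, ← mul_smul, pow_succ, sub_self]
      · obtain ⟨c, hc⟩ := hy r hr
        obtain ⟨e, he⟩ := hwl r hr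
        have he' := hw'l (r ^ e) (by rwa [map_pow])
        rw [map_pow] at he'
        have h1 : algebraMap R B r ^ (c + e) • y = 0 := by
          rw [add_comm c e, pow_add, mul_smul, hc, smul_zero]
        have h2 : algebraMap R B r ^ (c + e) • w' = 0 := by
          rw [pow_add, mul_smul, he', smul_zero]
        exact ⟨c + e, by rw [smul_sub, h1, ← map_smul, h2, map_zero, sub_zero]⟩

end Torsion

section FiniteLength

variable {R : Type*} [CommRing R] [IsLocalRing R]
variable {B : Type*} [Ring B] [Algebra R B] [Module.Finite R B]

lemma IsLocalRing.exists_list_mem_minimalPrimes [IsNoetherianRing R] {n : ℕ}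
    (hn : ringKrullDim R ≤ (n : WithBot ℕ∞)) :
    ∃ l : List R, l.length ≤ n ∧ maximalIdeal R ∈ (Ideal.span {x | x ∈ l}).minimalPrimes := by
  obtain ⟨s, hs, hc⟩ := (maximalIdeal R).exists_finset_card_eq_height_of_isNoetherianRing
  refine ⟨s.toList, ?_, by simpa using hs⟩
  rw [← maximalIdeal_height_eq_ringKrullDim, ← hc] at hn
  rw [Finset.length_toList]
  exact_mod_cast hn

lemma IsSimpleModule.algebraMap_smul_eq_zero {S : Type*} [AddCommGroup S] [Module B S]
    [IsSimpleModule B S] {r : R} (hr : r ∈ IsLocalRing.maximalIdeal R) (s : S) :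
    algebraMap R B r • s = 0 := by
  let _ := Module.compHom S (algebraMap R B)
  have : IsScalarTower R B S := IsScalarTower.of_algebraMap_smul fun _ _ ↦ rfl
  have : Module.Finite R S := Module.Finite.trans B S
  have : SMulCommClass B R S := SMulCommClass.symm _ _ _
  rcases LinearMap.bijective_or_eq_zero (r • (LinearMap.id : S →ₗ[B] S)) with h | h
  · have hS : (⊤ : Submodule R S) = ⊥ :=
      Submodule.eq_bot_of_le_smul_of_le_jacobson_bot (IsLocalRing.maximalIdeal R) _
        Module.Finite.fg_top (fun s _ ↦ by
          obtain ⟨t, rfl⟩ := h.2 s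
          exact Submodule.smul_mem_smul hr Submodule.mem_top)
        (IsLocalRing.maximalIdeal_le_jacobson _)
    have := IsSimpleModule.nontrivial B S
    exact absurd hS top_ne_bot
  · exact LinearMap.congr_fun h s

variable [IsNoetherianRing R]

/-- A finitely generated module supported at the closed point has finite length. -/
lemma isFiniteLength_of_pow_smul_eq_zero {s : Set R}
    (hs : IsLocalRing.maximalIdeal R ∈ (Ideal.span s).minimalPrimes)
    {L : Type*} [AddCommGroup L] [Module B L] [Module.Finite B L]
    (hL : ∀ x ∈ s, ∃ a : ℕ, ∀ v : L, algebraMap R B x ^ a • v = 0) :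
    IsFiniteLength B L := by
  rcases subsingleton_or_nontrivial L with h | h
  · exact .of_subsingleton
  let _ := Module.compHom L (algebraMap R B)
  have : IsScalarTower R B L := IsScalarTower.of_algebraMap_smul fun _ _ ↦ rfl
  have : Module.Finite R L := Module.Finite.trans B L
  let I := Module.annihilator R L
  have hI : I ≤ IsLocalRing.maximalIdeal R := IsLocalRing.le_maximalIdeal fun h ↦
    not_subsingleton L (Module.annihilator_eq_top_iff.1 h)
  have hmin : IsLocalRing.maximalIdeal R ∈ I.minimalPrimes := by
    refine ⟨⟨inferInstance, hI⟩, fun P hP _ ↦ hs.2 ⟨hP.1, Ideal.span_le.2 fun x hx ↦ ?_⟩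
      (IsLocalRing.le_maximalIdeal hP.1.ne_top)⟩
    obtain ⟨a, ha⟩ := hL x hx
    refine hP.1.mem_of_pow_mem a (hP.2 (Module.mem_annihilator.2 fun v ↦ ?_))
    rw [← algebraMap_smul B, map_pow, ha]
  have := IsLocalRing.quotient_artinian_of_mem_minimalPrimes_of_isLocalRing I hmin
  let _ : Module (R ⧸ I) L := Module.quotientAnnihilator
  have : IsScalarTower R (R ⧸ I) L := Module.IsTorsionBySet.isScalarTower _
  have : Module.Finite (R ⧸ I) L := Module.Finite.of_restrictScalars_finite R _ _
  have : IsArtinian R L := isArtinian_of_surjective_algebraMap (R := R ⧸ I)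
    Ideal.Quotient.mk_surjective
  exact isFiniteLength_iff_isNoetherian_isArtinian.2
    ⟨isNoetherian_of_tower R inferInstance, isArtinian_of_tower R inferInstance⟩

/-- A finitely generated module killed by the maximal ideal has finite length. -/
lemma isFiniteLength_of_maximalIdeal_smul_eq_zero {L : Type*} [AddCommGroup L] [Module B L]
    [Module.Finite B L]
    (hL : ∀ x ∈ IsLocalRing.maximalIdeal R, ∀ v : L, algebraMap R B x • v = 0) :
    IsFiniteLength B L :=
  isFiniteLength_of_pow_smul_eq_zero (R := R) (s := (IsLocalRing.maximalIdeal R : Set R))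
    (by rw [Ideal.span_eq, Ideal.minimalPrimes_eq_subsingleton_self]; rfl)
    fun x hx ↦ ⟨1, by simpa using hL x hx⟩

end FiniteLength

section ExtSimple

variable {R : Type*} [CommRing R] [IsNoetherianRing R] [IsLocalRing R]
variable {B : Type u} [Ring B] [Algebra R B] [Module.Finite R B]

/-- Over a Noether algebra, the vanishing of `Ext` from simple modules propagates upwards from
any positive degree that is at least the dimension of the base ring. -/
lemma subsingleton_ext_succ_of_isSimpleModule {M : ModuleCat.{u} B} {j : ℕ}
    (hj : ringKrullDim R ≤ ((j + 1 : ℕ) : WithBot ℕ∞))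
    (h : ∀ (S : Type u) [AddCommGroup S] [Module B S] [IsSimpleModule B S],
      Subsingleton (Abelian.Ext (ModuleCat.of B S) M (j + 1)))
    (S : Type u) [AddCommGroup S] [Module B S] [IsSimpleModule B S] :
    Subsingleton (Abelian.Ext (ModuleCat.of B S) M (j + 2)) := by
  have : IsNoetherianRing B := isNoetherian_of_tower R inferInstance
  obtain ⟨l, hl, hlm⟩ := IsLocalRing.exists_list_mem_minimalPrimes hj
  let I := injectiveResolution M
  have hinj (i : ℕ) : Module.Injective B (I.cocomplex.X i) :=
    @Module.injective_module_of_injective_object B _ _ _ _ (I.injective i)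
  let d (i : ℕ) : I.cocomplex.X i →ₗ[B] I.cocomplex.X (i + 1) := (I.cocomplex.d i (i + 1)).hom
  have hd (i : ℕ) : Function.Exact (d i) (d (i + 1)) :=
    (ShortComplex.ShortExact.moduleCat_exact_iff_function_exact _).1 (I.exact_succ i)
  refine subsingleton_of_forall_eq 0 fun α ↦ ?_
  obtain ⟨f, hf, rfl⟩ := I.extMk_surjective α (j + 3) rfl
  rw [I.extMk_eq_zero_iff f _ _ hf (j + 1) rfl]
  have := IsSimpleModule.nontrivial B S
  obtain ⟨s, hs⟩ := exists_ne (0 : S)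
  obtain ⟨y, hy, hly⟩ := exists_torsion_preimage_of_injective d hd l (j + 1) hl (f.hom s)
    congr(($hf).hom s) fun x hx ↦ ⟨1, by
      have hx : x ∈ IsLocalRing.maximalIdeal R := hlm.1.2 (Ideal.subset_span hx)
      rw [pow_one, ← map_smul, IsSimpleModule.algebraMap_smul_eq_zero hx, map_zero]⟩
  let K := (LinearMap.ker (LinearMap.toSpanSingleton B S s)).map
    (LinearMap.toSpanSingleton B (I.cocomplex.X (j + 1)) y)
  have hKmem {b : B} (hb : b • s = 0) : b • y ∈ K := ⟨b, hb, rfl⟩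
  have hKfin : Module.Finite B K := Module.Finite.iff_fg.2 ((IsNoetherian.noetherian _).map _)
  have hKlen : IsFiniteLength B K := isFiniteLength_of_pow_smul_eq_zero hlm fun x hx ↦ by
    obtain ⟨a, ha⟩ := hly x hx
    refine ⟨a, ?_⟩
    rintro ⟨_, b, -, rfl⟩
    ext
    simp only [Submodule.coe_smul, LinearMap.toSpanSingleton_apply, ZeroMemClass.coe_zero]
    rw [← map_pow, ← mul_smul, Algebra.commutes, mul_smul, map_pow, ha, smul_zero]
  have hKd : ModuleCat.ofHom K.subtype ≫ I.cocomplex.d (j + 1) (j + 2) = 0 := by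
    ext ⟨_, b, hb, rfl⟩
    change d (j + 1) (b • y) = 0
    rw [map_smul, hy, ← map_smul, show b • s = 0 from hb, map_zero]
  have := hKlen.subsingleton_ext h
  obtain ⟨g, hg⟩ := (I.extMk_eq_zero_iff _ _ rfl hKd j rfl).1 (Subsingleton.elim _ _)
  obtain ⟨U, hU⟩ := Module.Injective.exists_comp_eq_of_ker_le K.subtype g.hom
    (by rw [K.ker_subtype]; exact bot_le)
  obtain ⟨t, ht⟩ := Module.Injective.exists_comp_eq_of_ker_le (LinearMap.toSpanSingleton B S s)
    (LinearMap.toSpanSingleton B (I.cocomplex.X (j + 1)) (y - d j (U y))) fun b hb ↦ by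
      have h1 : U (b • y) = g.hom ⟨b • y, hKmem hb⟩ := LinearMap.congr_fun hU ⟨b • y, hKmem hb⟩
      have h2 : d j (g.hom ⟨b • y, hKmem hb⟩) = b • y := congr(($hg).hom ⟨b • y, hKmem hb⟩)
      rw [LinearMap.mem_ker, LinearMap.toSpanSingleton_apply, smul_sub, ← map_smul, ← map_smul,
        h1, h2, sub_self]
  have hts : t s = y - d j (U y) := by simpa using LinearMap.congr_fun ht 1
  refine ⟨ModuleCat.ofHom t, ?_⟩
  ext v
  obtain ⟨b, rfl⟩ := IsSimpleModule.toSpanSingleton_surjective B hs v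
  change d (j + 1) (t (b • s)) = f.hom (b • s)
  rw [map_smul, map_smul, map_smul, hts, map_sub, (hd j).apply_apply_eq_zero, sub_zero, hy]

end ExtSimple

section ExtFinite

variable (R : Type*) [CommRing R] {B : Type u} [Ring B] [Algebra R B]

/-- A module over an `R`-algebra, regarded as an `R`-module. -/
@[reducible]
def ModuleCat.moduleOfAlgebra (M : ModuleCat.{u} B) : Module R M :=
  Module.restrictScalars R B M

attribute [local instance] ModuleCat.moduleOfAlgebra

lemma ModuleCat.isScalarTower_moduleOfAlgebra (M : ModuleCat.{u} B) : IsScalarTower R B M :=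
  IsScalarTower.restrictScalars R B M

attribute [local instance] ModuleCat.isScalarTower_moduleOfAlgebra

/-- The category of modules over an `R`-algebra is `R`-linear. -/
@[reducible]
def ModuleCat.linearOfAlgebra : Linear R (ModuleCat.{u} B) where
  homModule _ _ := inferInstance

attribute [local instance] ModuleCat.linearOfAlgebra

lemma ModuleCat.finite_ext_of_algebra [IsNoetherianRing R] [Module.Finite R B]
    (N M : ModuleCat.{u} B) [Module.Finite B N] [Module.Finite B M] (i : ℕ) :
    Module.Finite R (Abelian.Ext N M i) := by
  have : IsNoetherianRing B := isNoetherian_of_tower R inferInstance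
  induction i generalizing N with
  | zero =>
    have : Module.Finite R N := Module.Finite.trans B N
    have : Module.Finite R M := Module.Finite.trans B M
    let φ : (N ⟶ M) →ₗ[R] (N →ₗ[R] M) :=
      { toFun f := f.hom.restrictScalars R
        map_add' _ _ := rfl
        map_smul' _ _ := rfl }
    have hφ : Function.Injective φ := fun f g h ↦ by
      ext x
      exact LinearMap.congr_fun h x
    have : Module.Finite R (N ⟶ M) := Module.Finite.of_injective φ hφ
    exact Module.Finite.equiv (Abelian.Ext.linearEquiv₀ (R := R)).symm
  | succ n ih =>
    obtain ⟨k, f, hf⟩ := Module.Finite.exists_fin' B N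
    let S := LinearMap.shortComplexKer f
    have hS : S.ShortExact := LinearMap.shortExact_shortComplexKer hf
    have : Projective S.X₂ := (IsProjective.iff_projective (Fin k → B)).1 inferInstance
    exact Module.Finite.of_surjective (hS.extClass.precompOfLinear R M (add_comm 1 n)) fun α ↦
      Abelian.Ext.contravariant_sequence_exact₃ hS M α (Abelian.Ext.eq_zero_of_projective _)
        (add_comm 1 n)

/-- Nakayama's lemma for `Ext` groups over a Noether algebra. -/
lemma ModuleCat.subsingleton_ext_of_surjective_smul [IsNoetherianRing R] [IsLocalRing R]
    [Module.Finite R B] (N M : ModuleCat.{u} B) [Module.Finite B N] [Module.Finite B M] (i : ℕ)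
    {r : R} (hr : r ∈ IsLocalRing.maximalIdeal R) (m : N ⟶ N)
    (hm : ∀ x, m x = algebraMap R B r • x)
    (h : ∀ α : Abelian.Ext N M i, ∃ β, (Abelian.Ext.mk₀ m).comp β (zero_add i) = α) :
    Subsingleton (Abelian.Ext N M i) := by
  have := ModuleCat.finite_ext_of_algebra R N M i
  have hm' : m = r • 𝟙 N := by
    ext x
    exact hm x
  have htop : (⊤ : Submodule R (Abelian.Ext N M i)) = ⊥ :=
    Submodule.eq_bot_of_le_smul_of_le_jacobson_bot (IsLocalRing.maximalIdeal R) _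
      Module.Finite.fg_top (fun α _ ↦ by
        obtain ⟨β, rfl⟩ := h α
        rw [hm', Abelian.Ext.mk₀_smul, Abelian.Ext.smul_comp, Abelian.Ext.mk₀_id_comp]
        exact Submodule.smul_mem_smul hr Submodule.mem_top)
      (IsLocalRing.maximalIdeal_le_jacobson _)
  exact (Submodule.subsingleton_iff R).1 (subsingleton_of_bot_eq_top htop.symm)

end ExtFinite

section Cyclic

/-- For a central element `c`, the sequence `B ⧸ (J : c) → B ⧸ J → B ⧸ (J + B c)` is short
exact. -/
lemma Ideal.exact_mapQ_toSpanSingleton_factor {B : Type*} [Ring B] (J J₁ : Ideal B) (c : B)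
    (hJ₁ : J₁ = Submodule.comap (LinearMap.toSpanSingleton B B c) J) :
    Function.Exact (Submodule.mapQ J₁ J (LinearMap.toSpanSingleton B B c) hJ₁.le)
        (Submodule.factor (le_sup_left : J ≤ J ⊔ Ideal.span {c})) ∧
      Function.Injective (Submodule.mapQ J₁ J (LinearMap.toSpanSingleton B B c) hJ₁.le) := by
  constructor
  · intro y
    obtain ⟨b, rfl⟩ := Submodule.Quotient.mk_surjective _ y
    rw [← Submodule.mkQ_apply, Submodule.factor_mk, Submodule.mkQ_apply,
      Submodule.Quotient.mk_eq_zero]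
    constructor
    · intro hb
      obtain ⟨j, hj, t, ht, rfl⟩ := Submodule.mem_sup.1 hb
      obtain ⟨a, rfl⟩ := Ideal.mem_span_singleton'.1 ht
      refine ⟨Submodule.Quotient.mk a, ?_⟩
      rw [Submodule.mapQ_apply, Submodule.mkQ_apply, Submodule.Quotient.eq]
      simpa using hj
    · rintro ⟨a, ha⟩
      obtain ⟨a, rfl⟩ := Submodule.Quotient.mk_surjective _ a
      rw [Submodule.mapQ_apply, Submodule.mkQ_apply, Submodule.Quotient.eq] at ha
      have hac : LinearMap.toSpanSingleton B B c a ∈ J ⊔ Ideal.span {c} :=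
        Submodule.mem_sup_right (Ideal.mem_span_singleton'.2 ⟨a, rfl⟩)
      simpa using sub_mem hac (Submodule.mem_sup_left ha)
  · rw [← LinearMap.ker_eq_bot, Submodule.ker_mapQ, ← hJ₁, Submodule.mkQ_map_self]

/-- Over a Noether algebra, the vanishing of `Ext` from simple modules in all large degrees
implies its vanishing from cyclic modules in the same degrees. -/
lemma subsingleton_ext_quotient_ideal (R : Type*) [CommRing R] [IsNoetherianRing R]
    [IsLocalRing R] {B : Type u} [Ring B] [Algebra R B] [Module.Finite R B]
    {M : ModuleCat.{u} B} [Module.Finite B M] {n : ℕ}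
    (h : ∀ i, n ≤ i → ∀ (S : Type u) [AddCommGroup S] [Module B S] [IsSimpleModule B S],
      Subsingleton (Abelian.Ext (ModuleCat.of B S) M i)) (J : Ideal B) :
    ∀ i, n ≤ i → Subsingleton (Abelian.Ext (ModuleCat.of B (B ⧸ J)) M i) := by
  have : IsNoetherianRing B := isNoetherian_of_tower R inferInstance
  induction J using IsNoetherian.induction with
  | hgt J ih =>
  intro i hi
  by_cases hJ : ∀ x ∈ IsLocalRing.maximalIdeal R, algebraMap R B x ∈ J
  · refine (isFiniteLength_of_maximalIdeal_smul_eq_zero (R := R) fun x hx v ↦ ?_).subsingleton_ext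
      (h i hi)
    obtain ⟨b, rfl⟩ := Submodule.Quotient.mk_surjective _ v
    rw [← Submodule.Quotient.mk_smul, Submodule.Quotient.mk_eq_zero, smul_eq_mul,
      Algebra.commutes]
    exact Ideal.mul_mem_left J b (hJ x hx)
  push Not at hJ
  obtain ⟨x, hx, hxJ⟩ := hJ
  let c := algebraMap R B x
  have hlt : J < J ⊔ Ideal.span {c} := lt_of_le_of_ne le_sup_left fun h ↦ hxJ <| by
    rw [h]
    exact Submodule.mem_sup_right (Ideal.mem_span_singleton_self c)
  have hle : J ≤ Submodule.comap (LinearMap.toSpanSingleton B B c) J := fun b hb ↦ by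
    rw [Submodule.mem_comap, LinearMap.toSpanSingleton_apply, smul_eq_mul, ← Algebra.commutes]
    exact Ideal.mul_mem_left J _ hb
  rcases hle.lt_or_eq with hlt' | heq
  · obtain ⟨h1, h2⟩ := Ideal.exact_mapQ_toSpanSingleton_factor J _ c rfl
    exact (LinearMap.shortExact_mk_ofHom h1 h2 (Submodule.factor_surjective _)).subsingleton_ext_X₂
      (ih _ hlt' i hi) (ih _ hlt i hi)
  · obtain ⟨h1, h2⟩ := Ideal.exact_mapQ_toSpanSingleton_factor J J c heq
    have hS := LinearMap.shortExact_mk_ofHom h1 h2 (Submodule.factor_surjective _)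
    have := ih _ hlt (i + 1) (by lia)
    refine ModuleCat.subsingleton_ext_of_surjective_smul R _ M i hx
      (ModuleCat.ofHom (Submodule.mapQ J J (LinearMap.toSpanSingleton B B c) heq.le)) (fun b ↦ ?_)
      fun α ↦ Abelian.Ext.contravariant_sequence_exact₁ hS M α (add_comm 1 i)
        (Subsingleton.elim _ _)
    obtain ⟨b, rfl⟩ := Submodule.Quotient.mk_surjective _ b
    change Submodule.Quotient.mk (b • c) = Submodule.Quotient.mk (algebraMap R B x • b)
    rw [smul_eq_mul, smul_eq_mul, Algebra.commutes]

end Cyclic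

section Jacobson

lemma exists_mul_mul_add_eq_one_of_forall {A : Type*} [Ring A] {x : A}
    (h : ∀ y, ∃ z, z * y * x + z = 1) (y : A) : ∃ z, x * y * z + z = 1 := by
  obtain ⟨z, hz⟩ := h y
  obtain ⟨w, hw⟩ := h (-(z * y))
  have hwz : w * z = 1 := by
    calc w * z = w * (z * y * x + z) - w * (z * y * x) := by noncomm_ring
      _ = w * -(z * y) * x + w := by rw [hz]; noncomm_ring
      _ = 1 := hw
  have hw' : w = y * x + 1 := by
    calc w = w * (z * y * x + z) := by rw [hz, mul_one]
      _ = (w * z) * (y * x) + w * z := by noncomm_ring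
      _ = y * x + 1 := by rw [hwz, one_mul]
  rw [hw'] at hwz
  refine ⟨1 - x * z * y, ?_⟩
  calc x * y * (1 - x * z * y) + (1 - x * z * y) = x * y + 1 - x * ((y * x + 1) * z) * y := by
        noncomm_ring
    _ = 1 := by rw [hwz, mul_one, add_sub_cancel_left]

lemma Ring.mem_jacobson_iff {A : Type*} [Ring A] {x : A} :
    x ∈ Ring.jacobson A ↔ ∀ y, ∃ z, z * y * x + z = 1 := by
  have : Ring.jacobson A = Ideal.jacobson ⊥ := by
    simp [Ring.jacobson_eq_sInf_isMaximal, Ideal.jacobson]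
  simp only [this, Ideal.mem_jacobson_iff, Ideal.mem_bot, sub_eq_zero]

/-- The Jacobson radical is left-right symmetric. -/
lemma radRight_eq_jacobson (A : Type u) [Ring A] : radRight A = Ring.jacobson Aᵐᵒᵖ := by
  ext x
  change x.unop ∈ TwoSidedIdeal.jacobson ⊥ ↔ _
  simp only [TwoSidedIdeal.mem_jacobson_iff, TwoSidedIdeal.mem_bot, sub_eq_zero,
    Ring.mem_jacobson_iff]
  constructor
  · intro h y
    obtain ⟨z, hz⟩ := exists_mul_mul_add_eq_one_of_forall h y.unop
    exact ⟨.op z, MulOpposite.unop_injective (by simpa [mul_assoc] using hz)⟩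
  · intro h y
    obtain ⟨z, hz⟩ := exists_mul_mul_add_eq_one_of_forall h (.op y)
    exact ⟨z.unop, MulOpposite.op_injective (by simpa [mul_assoc] using hz)⟩

/-- Over a Noether algebra `B`, every simple module is a direct summand of `B ⧸ rad B`. -/
lemma subsingleton_ext_of_isSimpleModule_of_jacobson (R : Type*) [CommRing R] [IsNoetherianRing R]
    [IsLocalRing R] {B : Type u} [Ring B] [Algebra R B] [Module.Finite R B] {M : ModuleCat.{u} B}
    {n : ℕ} {J : Ideal B} (hJ : J = Ring.jacobson B)
    (h : Subsingleton (Abelian.Ext (ModuleCat.of B (B ⧸ J)) M n))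
    (S : Type u) [AddCommGroup S] [Module B S] [IsSimpleModule B S] :
    Subsingleton (Abelian.Ext (ModuleCat.of B S) M n) := by
  subst hJ
  have hfin : IsFiniteLength B (B ⧸ Ring.jacobson B) := by
    refine isFiniteLength_of_maximalIdeal_smul_eq_zero (R := R) fun x hx v ↦ ?_
    obtain ⟨b, rfl⟩ := Submodule.Quotient.mk_surjective _ v
    rw [← Submodule.Quotient.mk_smul, Submodule.Quotient.mk_eq_zero, smul_eq_mul,
      Algebra.commutes]
    refine Ideal.mul_mem_left _ b ?_
    rw [Ring.jacobson_eq_sInf_isMaximal, Ideal.mem_sInf]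
    intro I hI
    have : IsSimpleModule B (B ⧸ I) := isSimpleModule_iff_isCoatom.2 (Ideal.isMaximal_def.1 hI)
    have := IsSimpleModule.algebraMap_smul_eq_zero (B := B) hx (Submodule.Quotient.mk 1 : B ⧸ I)
    rwa [← Submodule.Quotient.mk_smul, Submodule.Quotient.mk_eq_zero, smul_eq_mul, mul_one] at this
  have := (isFiniteLength_iff_isNoetherian_isArtinian.1 hfin).2
  have : IsSemisimpleModule B (B ⧸ Ring.jacobson B) :=
    (IsArtinian.isSemisimpleModule_iff_jacobson _ _).2 (Module.jacobson_quotient_jacobson _ _)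
  have := IsSimpleModule.nontrivial B S
  obtain ⟨s, hs⟩ := exists_ne (0 : S)
  have := IsSimpleModule.ker_toSpanSingleton_isMaximal B hs
  let p := (Ring.jacobson B).liftQ (LinearMap.toSpanSingleton B S s)
    (Ring.jacobson_le_of_isMaximal _)
  have hp : Function.Surjective p := fun v ↦ by
    obtain ⟨b, rfl⟩ := IsSimpleModule.toSpanSingleton_surjective B hs v
    exact ⟨Submodule.Quotient.mk b, rfl⟩
  obtain ⟨q, hq⟩ := IsSemisimpleModule.lifting_property p hp LinearMap.id
  exact Retract.subsingleton_ext (Y := ModuleCat.of B (B ⧸ Ring.jacobson B))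
    { i := ModuleCat.ofHom q
      r := ModuleCat.ofHom p
      retract := by rw [← ModuleCat.ofHom_comp, hq, ModuleCat.ofHom_id] } h

end Jacobson

/-- Let `R` be a commutative noetherian local ring and `A` a Noether
`R`-algebra.  Let `M` be a nonzero finitely generated right `A`-module with
`Ext^n_A(A/rad A, M) = 0` for some `n ≥ dim R`.  Then the injective dimension of `M` as a
right `A`-module is at most `n - 1`. -/
theorem injectiveDimension_le_of_ext_jacobson_vanishing
    (R : Type u) [CommRing R] [IsNoetherianRing R] [IsLocalRing R]
    (A : Type u) [Ring A] [Algebra R A] [Module.Finite R A]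
    (M : Type u) [AddCommGroup M] [Module Aᵐᵒᵖ M] [Module.Finite Aᵐᵒᵖ M]
    (hM : Nontrivial M)
    (n : ℕ) (hn : ringKrullDim R ≤ (n : WithBot ℕ∞))
    (hvanish : Subsingleton
      (extGrp Aᵐᵒᵖ n (ModuleCat.of Aᵐᵒᵖ (modRad A)) (ModuleCat.of Aᵐᵒᵖ M))) :
    hasInjDimLE Aᵐᵒᵖ (n - 1) (ModuleCat.of Aᵐᵒᵖ M) := by
  have hsimple := fun (S : Type u) [AddCommGroup S] [Module Aᵐᵒᵖ S] [IsSimpleModule Aᵐᵒᵖ S] ↦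
    subsingleton_ext_of_isSimpleModule_of_jacobson R (radRight_eq_jacobson A)
      (subsingleton_ext_of_classicalExt hvanish) S
  cases n with
  | zero =>
    obtain ⟨l, hl, hlm⟩ := IsLocalRing.exists_list_mem_minimalPrimes hn
    obtain rfl : l = [] := List.length_eq_zero_iff.1 (Nat.le_zero.1 hl)
    have hMM := (isFiniteLength_of_pow_smul_eq_zero (B := Aᵐᵒᵖ) (L := M) hlm
      (by simp)).subsingleton_ext hsimple
    have hid : 𝟙 (ModuleCat.of Aᵐᵒᵖ M) = 0 :=
      (Abelian.Ext.mk₀_bijective _ _).1 (Subsingleton.elim _ _)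
    obtain ⟨v, hv⟩ := exists_ne (0 : M)
    exact absurd congr(($hid).hom v) hv
  | succ k =>
    have hall (i : ℕ) (hi : k + 1 ≤ i) : ∀ (S : Type u) [AddCommGroup S] [Module Aᵐᵒᵖ S]
        [IsSimpleModule Aᵐᵒᵖ S],
        Subsingleton (Abelian.Ext (ModuleCat.of Aᵐᵒᵖ S) (ModuleCat.of Aᵐᵒᵖ M) i) := by
      induction i, hi using Nat.le_induction with
      | base => exact hsimple
      | succ i hi ih =>
        obtain ⟨j, rfl⟩ : ∃ j, i = j + 1 := ⟨i - 1, by lia⟩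
        exact subsingleton_ext_succ_of_isSimpleModule (R := R)
          (hn.trans (by exact_mod_cast hi)) ih
    have : HasInjectiveDimensionLT (ModuleCat.of Aᵐᵒᵖ M) (k + 1) :=
      hasInjectiveDimensionLT_of_ext_quotient_ideal fun J ↦
        subsingleton_ext_quotient_ideal R hall J (k + 1) le_rfl
    intro i hi N
    obtain ⟨j, rfl⟩ : ∃ j, i = j + 1 := ⟨i - 1, by lia⟩
    exact subsingleton_classicalExt_of_ext
      (HasInjectiveDimensionLT.subsingleton _ (k + 1) (j + 1) (by lia) _)
end

section
/- Let R be a commutative noetherian local ring and A a Noether R-algebra. Let M be a finitely generated right A-module, and assume that Ext^n_A(A/rad A, M) = 0 for some natural number n with n ≥ dim R, where dim R is the Krull dimension of R. Then Ext^i_A(A/rad A, M) = 0 for every i ≥ n. -/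
open CategoryTheory

universe u

namespace NoetherAlgebra

/-- A module over an `R`-algebra is an `R`-module. -/
@[reducible] def restrictedModule (R : Type u) [CommRing R] {B : Type u} [Ring B] [Algebra R B]
    (N : ModuleCat.{u} B) : Module R N :=
  Module.restrictScalars R B N

attribute [local instance] restrictedModule

theorem isScalarTower_restrictedModule (R : Type u) [CommRing R] {B : Type u} [Ring B]
    [Algebra R B] (N : ModuleCat.{u} B) : IsScalarTower R B N :=
  IsScalarTower.restrictScalars R B N

attribute [local instance] isScalarTower_restrictedModule

/-- The `R`-linear structure on the category of modules over an `R`-algebra. -/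
@[reducible] noncomputable def linearModuleCat (R : Type u) [CommRing R] (B : Type u) [Ring B]
    [Algebra R B] : Linear R (ModuleCat.{u} B) where
  homModule _ _ := inferInstance

attribute [local instance] linearModuleCat

open Abelian

variable {R : Type u} [CommRing R] {B : Type u} [Ring B] [Algebra R B]

lemma smul_id_apply (r : R) (N : ModuleCat.{u} B) (x : N) :
    (r • 𝟙 N : N ⟶ N) x = algebraMap R B r • x := rfl

/-- Elements of `R` annihilating `N` annihilate the Ext groups out of `N`. -/
lemma smul_ext_eq_zero {N Y : ModuleCat.{u} B} {r : R} (h : ∀ x : N, algebraMap R B r • x = 0)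
    {j : ℕ} (e : Ext N Y j) : r • e = 0 := by
  have h0 : (r • 𝟙 N : N ⟶ N) = 0 := by
    ext x
    exact h x
  have : r • e = (Ext.mk₀ (r • 𝟙 N)).comp e (zero_add j) := by simp [Ext.mk₀_smul]
  rw [this, h0, Ext.mk₀_zero, Ext.zero_comp]

section exact

variable {S : ShortComplex (ModuleCat.{u} B)} (hS : S.ShortExact) (Y : ModuleCat.{u} B) {j : ℕ}

include hS in
lemma notMem_support_ext_of_shortExact {p : PrimeSpectrum R}
    (h₁ : p ∉ Module.support R (Ext S.X₁ Y j)) (h₃ : p ∉ Module.support R (Ext S.X₃ Y j)) :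
    p ∉ Module.support R (Ext S.X₂ Y j) := by
  rw [Module.notMem_support_iff'] at *
  intro e
  obtain ⟨r, hr, hre⟩ := h₁ ((Ext.mk₀ S.f).comp e (zero_add j))
  obtain ⟨e', he'⟩ := Ext.contravariant_sequence_exact₂ hS Y (r • e) (by simpa using hre)
  obtain ⟨t, ht, hte⟩ := h₃ e'
  refine ⟨t * r, fun h => (p.2.mem_or_mem h).elim ht hr, ?_⟩
  rw [mul_smul, ← he', ← Ext.comp_smul, hte, Ext.comp_zero]

include hS in
lemma subsingleton_ext_of_shortExact
    (h₁ : Subsingleton (Ext S.X₁ Y j)) (h₃ : Subsingleton (Ext S.X₃ Y j)) :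
    Subsingleton (Ext S.X₂ Y j) := by
  refine subsingleton_of_forall_eq 0 fun e => ?_
  obtain ⟨e', he'⟩ := Ext.contravariant_sequence_exact₂ hS Y e (Subsingleton.elim _ _)
  rw [← he', Subsingleton.elim e' 0, Ext.comp_zero]

end exact

/-- The short exact sequence of a submodule and its quotient. -/
lemma shortExact_submodule {N : ModuleCat.{u} B} (P : Submodule B N) :
    (ShortComplex.mk (ModuleCat.ofHom P.subtype) (ModuleCat.ofHom P.mkQ) (by
      ext x; simp)).ShortExact :=
  ModuleCat.shortComplex_shortExact _ (LinearMap.exact_subtype_mkQ P) P.injective_subtype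
    P.mkQ_surjective

/-- The image of multiplication by `x : R` on `N`. -/
abbrev mulRange (x : R) (N : ModuleCat.{u} B) : Submodule B N :=
  LinearMap.range (x • 𝟙 N : N ⟶ N).hom

/-- The short exact sequence given by an injective multiplication. -/
lemma shortExact_mul {N : ModuleCat.{u} B} {x : R}
    (hx : ∀ y : N, algebraMap R B x • y = 0 → y = 0) :
    (ShortComplex.mk (x • 𝟙 N : N ⟶ N) (ModuleCat.ofHom (mulRange x N).mkQ) (by
      ext y; exact (Submodule.Quotient.mk_eq_zero _).2 ⟨y, rfl⟩)).ShortExact :=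
  ModuleCat.shortComplex_shortExact _ (LinearMap.exact_map_mkQ_range _)
    ((injective_iff_map_eq_zero (x • 𝟙 N : N ⟶ N).hom).2 hx) (Submodule.mkQ_surjective _)

section mul

variable {N Y : ModuleCat.{u} B} {x : R} (hx : ∀ y : N, algebraMap R B x • y = 0 → y = 0)

include hx in
lemma exists_comp_eq_of_smul_eq_zero {j : ℕ} (e : Ext N Y j) (he : x • e = 0) :
    ∃ e' : Ext (ModuleCat.of B (N ⧸ mulRange x N)) Y j,
      (Ext.mk₀ (ModuleCat.ofHom (mulRange x N).mkQ)).comp e' (zero_add j) = e :=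
  Ext.contravariant_sequence_exact₂ (shortExact_mul hx) Y e (by simpa [Ext.mk₀_smul] using he)

include hx in
/-- A form of Nakayama's lemma along multiplication by `x`. -/
lemma notMem_support_ext_of_quotient_succ {j : ℕ} [Module.Finite R (Ext N Y j)]
    {q : PrimeSpectrum R} (hxq : x ∈ q.asIdeal)
    (h : q ∉ Module.support R (Ext (ModuleCat.of B (N ⧸ mulRange x N)) Y (j + 1))) :
    q ∉ Module.support R (Ext N Y j) := by
  intro hq
  have hq' : q ∈ Module.support R (QuotSMulTop x (Ext N Y j)) := by
    rw [Module.support_quotSMulTop]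
    exact ⟨hq, by simpa [PrimeSpectrum.mem_zeroLocus] using hxq⟩
  refine absurd hq' (Module.notMem_support_iff'.2 fun c => ?_)
  obtain ⟨e, rfl⟩ := Submodule.mkQ_surjective _ c
  obtain ⟨r, hr, hre⟩ := Module.notMem_support_iff'.1 h
    ((shortExact_mul hx).extClass.comp e (add_comm 1 j))
  obtain ⟨e', he'⟩ := Ext.contravariant_sequence_exact₁ (shortExact_mul hx) Y (r • e)
    (add_comm 1 j) (by simpa using hre)
  refine ⟨r, hr, ?_⟩
  rw [← map_smul, Submodule.mkQ_apply, Submodule.Quotient.mk_eq_zero, ← he']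
  simpa [Ext.mk₀_smul] using Submodule.smul_mem_pointwise_smul e' x ⊤ trivial

end mul

/-- A free cover of a finite module with kernel finite over a Noetherian ring. -/
lemma exists_shortExact_projective [IsNoetherianRing B] (N : ModuleCat.{u} B)
    [Module.Finite B N] : ∃ S : ShortComplex (ModuleCat.{u} B), S.ShortExact ∧ S.X₃ = N ∧
      Module.Finite B S.X₁ ∧ Projective S.X₂ := by
  obtain ⟨n, f, surjf⟩ := Module.Finite.exists_fin' B N
  exact ⟨f.shortComplexKer, LinearMap.shortExact_shortComplexKer surjf, rfl,
    inferInstanceAs (Module.Finite B (LinearMap.ker f)), inferInstance⟩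

lemma subsingleton_ext_succ [IsNoetherianRing B] {Y : ModuleCat.{u} B} {j : ℕ}
    (h : ∀ (N : ModuleCat.{u} B) [Module.Finite B N], Subsingleton (Ext N Y j))
    (N : ModuleCat.{u} B) [Module.Finite B N] : Subsingleton (Ext N Y (j + 1)) := by
  obtain ⟨S, hS, rfl, _, _⟩ := exists_shortExact_projective N
  have := h S.X₁
  exact (precomp_extClass_surjective_of_projective_X₂ Y hS j).subsingleton

lemma notMem_support_ext_succ [IsNoetherianRing B] {Y : ModuleCat.{u} B} {j : ℕ}
    {p : PrimeSpectrum R}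
    (h : ∀ (N : ModuleCat.{u} B) [Module.Finite B N], p ∉ Module.support R (Ext N Y j))
    (N : ModuleCat.{u} B) [Module.Finite B N] : p ∉ Module.support R (Ext N Y (j + 1)) := by
  obtain ⟨S, hS, rfl, _, _⟩ := exists_shortExact_projective N
  exact fun hp => h S.X₁ (Module.support_subset_of_surjective
    (hS.extClass.precompOfLinear R Y (add_comm 1 j))
    (precomp_extClass_surjective_of_projective_X₂ Y hS j) hp)

/-- Ext groups between finite modules over a Noether algebra are finite. -/
lemma finite_ext [IsNoetherianRing R] [Module.Finite R B] (N Y : ModuleCat.{u} B)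
    [Module.Finite B N] [Module.Finite B Y] (j : ℕ) : Module.Finite R (Ext N Y j) := by
  have : IsNoetherianRing B := IsNoetherianRing.of_finite R B
  induction j generalizing N with
  | zero =>
    obtain ⟨n, g, hg⟩ := Module.Finite.exists_fin (R := B) (M := N)
    have : Module.Finite R Y := Module.Finite.trans B Y
    let f : (N ⟶ Y) →ₗ[R] (Fin n → Y) :=
      { toFun φ i := φ (g i)
        map_add' _ _ := rfl
        map_smul' _ _ := rfl }
    have hf : Function.Injective f := fun φ ψ h => by
      ext1
      exact LinearMap.ext_on hg (Set.forall_mem_range.2 fun i => congrFun h i)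
    have := Module.Finite.of_injective f hf
    exact Module.Finite.equiv (Ext.linearEquiv₀ (R := R)).symm
  | succ j ih =>
    obtain ⟨S, hS, rfl, _, _⟩ := exists_shortExact_projective N
    have := ih S.X₁
    exact Module.Finite.of_surjective (hS.extClass.precompOfLinear R Y (add_comm 1 j))
      (precomp_extClass_surjective_of_projective_X₂ Y hS j)

/-- Up to an element outside `q`, a minimal prime `q` of `J` is nilpotent modulo `J`. -/
lemma exists_mul_pow_mem_of_mem_minimalPrimes [IsNoetherianRing R] {q J : Ideal R}
    (hq : q ∈ J.minimalPrimes) : ∃ t ∉ q, ∃ k, ∀ y ∈ q ^ k, t * y ∈ J := by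
  classical
  obtain ⟨n, hn⟩ := J.exists_radical_pow_le_of_fg J.radical.fg_of_isNoetherianRing
  have h := J.finite_minimalPrimes_of_isNoetherianRing R
  have hqp : q.IsPrime := hq.isPrime
  rw [← J.sInf_minimalPrimes, ← h.coe_toFinset, ← h.toFinset.inf_id_eq_sInf,
    ← Finset.insert_erase (h.mem_toFinset.mpr hq), Finset.inf_insert, id_eq] at hn
  grw [← Ideal.mul_le_inf, mul_pow] at hn
  have hJ : ¬ (h.toFinset.erase q).inf id ≤ q := by
    rw [hqp.inf_le']
    rintro ⟨K, hK, hKq⟩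
    rw [Finset.mem_erase, h.mem_toFinset] at hK
    exact hK.1 (le_antisymm hKq (hq.2 hK.2.1 hKq))
  obtain ⟨t, ht, htq⟩ := SetLike.not_le_iff_exists.1 hJ
  refine ⟨t ^ n, fun h => htq (hqp.mem_of_pow_mem n h), n, fun y hy => ?_⟩
  rw [mul_comm]
  exact hn (Ideal.mul_mem_mul hy (Ideal.pow_mem_pow ht n))

variable (R) in
/-- The annihilator in `R` of a module over an `R`-algebra. -/
def baseAnnihilator (N : ModuleCat.{u} B) : Ideal R where
  carrier := {r | ∀ x : N, algebraMap R B r • x = 0}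
  add_mem' ha hb x := by rw [map_add, add_smul, ha, hb, add_zero]
  zero_mem' x := by rw [map_zero, zero_smul]
  smul_mem' c a ha x := by rw [smul_eq_mul, map_mul, mul_smul, ha, smul_zero]

lemma mem_baseAnnihilator {N : ModuleCat.{u} B} {r : R} :
    r ∈ baseAnnihilator R N ↔ ∀ x : N, algebraMap R B r • x = 0 := Iff.rfl

lemma baseAnnihilator_le_submodule {N : ModuleCat.{u} B} (P : Submodule B N) :
    baseAnnihilator R N ≤ baseAnnihilator R (ModuleCat.of B P) :=
  fun _ hr x => Subtype.ext (hr x)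

lemma mem_baseAnnihilator_quotient {N : ModuleCat.{u} B} {P : Submodule B N} {r : R} :
    r ∈ baseAnnihilator R (ModuleCat.of B (N ⧸ P)) ↔ ∀ x : N, algebraMap R B r • x ∈ P := by
  refine ⟨fun h x => (Submodule.Quotient.mk_eq_zero P).1 (h (P.mkQ x)), fun h y => ?_⟩
  obtain ⟨x, rfl⟩ := P.mkQ_surjective y
  exact (Submodule.Quotient.mk_eq_zero P).2 (h x)

lemma baseAnnihilator_le_quotient {N : ModuleCat.{u} B} (P : Submodule B N) :
    baseAnnihilator R N ≤ baseAnnihilator R (ModuleCat.of B (N ⧸ P)) :=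
  fun r hr => mem_baseAnnihilator_quotient.2 fun x => by rw [hr x]; exact P.zero_mem

lemma self_mem_baseAnnihilator_mulRange (x : R) (N : ModuleCat.{u} B) :
    x ∈ baseAnnihilator R (ModuleCat.of B (N ⧸ mulRange x N)) :=
  mem_baseAnnihilator_quotient.2 fun y => ⟨y, rfl⟩

lemma notMem_support_ext_of_mem_baseAnnihilator {N Y : ModuleCat.{u} B} {j : ℕ}
    {p : PrimeSpectrum R} {r : R} (hr : r ∈ baseAnnihilator R N) (hrp : r ∉ p.asIdeal) :
    p ∉ Module.support R (Ext N Y j) :=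
  Module.notMem_support_iff'.2 fun e => ⟨r, hrp, smul_ext_eq_zero hr e⟩

/-- The vanishing at `p` of `Ext^j(N, Y)` for the finite modules `N` killed by a power of `p`. -/
def PrimaryVanishing (Y : ModuleCat.{u} B) (p : PrimeSpectrum R) (j : ℕ) : Prop :=
  ∀ (N : ModuleCat.{u} B) [Module.Finite B N] (k : ℕ), p.asIdeal ^ k ≤ baseAnnihilator R N →
    p ∉ Module.support R (Ext N Y j)

lemma PrimaryVanishing.of_mul_mem {Y : ModuleCat.{u} B} {q : PrimeSpectrum R} {j : ℕ}
    [IsNoetherianRing B] (h : PrimaryVanishing Y q j) (N : ModuleCat.{u} B) [Module.Finite B N]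
    {s : R} (hs : s ∉ q.asIdeal) {k : ℕ}
    (hk : ∀ y ∈ q.asIdeal ^ k, s * y ∈ baseAnnihilator R N) :
    q ∉ Module.support R (Ext N Y j) := by
  let K : Submodule B N := LinearMap.ker (s • 𝟙 N : N ⟶ N).hom
  refine notMem_support_ext_of_shortExact (shortExact_submodule K) Y
    (notMem_support_ext_of_mem_baseAnnihilator (r := s) (fun x => Subtype.ext x.2) hs)
    (h (ModuleCat.of B (N ⧸ K)) k fun y hy => mem_baseAnnihilator_quotient.2 fun x => ?_)
  have := hk y hy x
  rw [map_mul, mul_smul] at this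
  exact this

/-- The `x`-power torsion of a Noetherian module splits off as a submodule killed by a
power of `x`. -/
lemma exists_pow_mem_baseAnnihilator (x : R) (N : ModuleCat.{u} B) [IsNoetherian B N] :
    ∃ (K : Submodule B N) (m : ℕ), x ^ m ∈ baseAnnihilator R (ModuleCat.of B K) ∧
      ∀ y : N ⧸ K, algebraMap R B x • y = 0 → y = 0 := by
  let f : ℕ →o Submodule B N :=
    { toFun m := LinearMap.ker (x ^ m • 𝟙 N : N ⟶ N).hom
      monotone' := monotone_nat_of_le_succ fun m y (hy : algebraMap R B (x ^ m) • y = 0) => by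
        change algebraMap R B (x ^ (m + 1)) • y = 0
        rw [pow_succ', map_mul, mul_smul, hy, smul_zero] }
  obtain ⟨m, hm⟩ := monotone_stabilizes_iff_noetherian.2 ‹_› f
  refine ⟨f m, m, fun y => Subtype.ext y.2, fun y hy => ?_⟩
  obtain ⟨y, rfl⟩ := (f m).mkQ_surjective y
  have h1 : algebraMap R B x • y ∈ f m := (Submodule.Quotient.mk_eq_zero _).1 hy
  refine (Submodule.Quotient.mk_eq_zero _).2 ?_
  rw [hm (m + 1) m.le_succ]
  change algebraMap R B (x ^ (m + 1)) • y = 0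
  rw [pow_succ, map_mul, mul_smul]
  exact h1

section finite

variable [IsNoetherianRing R] [Module.Finite R B] {Y : ModuleCat.{u} B} [Module.Finite B Y]

/-- Primary vanishing descends along coverings of primes. -/
lemma PrimaryVanishing.of_covBy {p q : PrimeSpectrum R} (hpq : p ⋖ q) {j : ℕ}
    (h : PrimaryVanishing Y q (j + 1)) : PrimaryVanishing Y p j := by
  intro N _ k hk
  have : IsNoetherianRing B := IsNoetherianRing.of_finite R B
  obtain ⟨x, hxq, hxp⟩ := SetLike.exists_of_lt (PrimeSpectrum.asIdeal_lt_asIdeal p q |>.2 hpq.lt)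
  obtain ⟨K, m, hK, hx⟩ := exists_pow_mem_baseAnnihilator x N
  refine notMem_support_ext_of_shortExact (shortExact_submodule K) Y
    (notMem_support_ext_of_mem_baseAnnihilator hK fun hm => hxp (p.2.mem_of_pow_mem m hm)) ?_
  set N' : ModuleCat.{u} B := ModuleCat.of B (N ⧸ K)
  have : Module.Finite B N' := inferInstanceAs (Module.Finite B (N ⧸ K))
  have := finite_ext (R := R) N' Y j
  refine mt (Module.mem_support_mono hpq.le)
    (notMem_support_ext_of_quotient_succ (N := N') hx hxq ?_)
  have hann : p.asIdeal ^ (k + 1) ⊔ Ideal.span {x} ≤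
      baseAnnihilator R (ModuleCat.of B (N' ⧸ mulRange x N')) :=
    sup_le ((((Ideal.pow_le_pow_right k.le_succ).trans hk).trans
      (baseAnnihilator_le_quotient K)).trans (baseAnnihilator_le_quotient (N := N') _))
      ((Ideal.span_singleton_le_iff_mem _).2 (self_mem_baseAnnihilator_mulRange x N'))
  have hmin : q.asIdeal ∈ (p.asIdeal ^ (k + 1) ⊔ Ideal.span {x}).minimalPrimes := by
    refine ⟨⟨q.2, sup_le ((Ideal.pow_le_self k.succ_ne_zero).trans hpq.le)
      ((Ideal.span_singleton_le_iff_mem _).2 hxq)⟩, fun q' hq' hle => ?_⟩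
    have hpq' : p.asIdeal < q' := lt_of_le_of_ne
      ((hq'.1.pow_le_iff k.succ_ne_zero).1 (le_sup_left.trans hq'.2)) fun he =>
        hxp (he ▸ hq'.2 (Ideal.mem_sup_right (Ideal.mem_span_singleton_self x)))
    by_contra hne
    exact hpq.2 (c := ⟨q', hq'.1⟩) hpq' (lt_of_le_not_ge hle hne)
  obtain ⟨t, ht, l, hl⟩ := exists_mul_pow_mem_of_mem_minimalPrimes hmin
  exact h.of_mul_mem (ModuleCat.of B (N' ⧸ mulRange x N')) ht fun y hy => hann (hl y hy)

/-- Primary vanishing at `p`, and vanishing below `p`, give vanishing at `p`. -/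
lemma PrimaryVanishing.notMem_support {p : PrimeSpectrum R} {j : ℕ}
    (h : PrimaryVanishing Y p j)
    (hlt : ∀ p' < p, ∀ (N : ModuleCat.{u} B) [Module.Finite B N],
      p' ∉ Module.support R (Ext N Y j))
    (N : ModuleCat.{u} B) [Module.Finite B N] : p ∉ Module.support R (Ext N Y j) := by
  have : IsNoetherianRing B := IsNoetherianRing.of_finite R B
  suffices H : ∀ I : Ideal R, ∀ (N : ModuleCat.{u} B) [Module.Finite B N],
      I ≤ baseAnnihilator R N → p ∉ Module.support R (Ext N Y j) from H ⊥ N bot_le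
  intro I
  induction I using WellFoundedGT.induction with
  | ind I ih =>
  intro N _ hI
  by_cases hp : ∀ x ∈ p.asIdeal, ∃ m, x ^ m ∈ I
  · obtain ⟨k, hk⟩ := Ideal.exists_pow_le_of_le_radical_of_fg (I := p.asIdeal) (J := I) hp
      p.asIdeal.fg_of_isNoetherianRing
    exact h N k (hk.trans hI)
  push Not at hp
  obtain ⟨x, hxp, hxI⟩ := hp
  have hlt' (m : ℕ) : I < I ⊔ Ideal.span {x ^ m} :=
    lt_of_le_of_ne le_sup_left fun he => hxI m (he ▸
      (le_sup_right : Ideal.span {x ^ m} ≤ _) (Ideal.mem_span_singleton_self _))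
  obtain ⟨K, m, hK, hx⟩ := exists_pow_mem_baseAnnihilator x N
  refine notMem_support_ext_of_shortExact (shortExact_submodule K) Y
    (ih _ (hlt' m) (ModuleCat.of B K) (sup_le (hI.trans (baseAnnihilator_le_submodule K))
      ((Ideal.span_singleton_le_iff_mem _).2 hK))) ?_
  set N' : ModuleCat.{u} B := ModuleCat.of B (N ⧸ K)
  have : Module.Finite B N' := inferInstanceAs (Module.Finite B (N ⧸ K))
  have := finite_ext (R := R) N' Y j
  have hq := ih _ (hlt' 1) (ModuleCat.of B (N' ⧸ mulRange x N'))
    (sup_le ((hI.trans (baseAnnihilator_le_quotient K)).trans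
      (baseAnnihilator_le_quotient (N := N') _))
      ((Ideal.span_singleton_le_iff_mem _).2 (by
        rw [pow_one]; exact self_mem_baseAnnihilator_mulRange x N')))
  intro hps
  have hmin : p.asIdeal ∈ (Module.annihilator R (Ext N' Y j)).minimalPrimes := by
    refine ⟨⟨p.2, Module.annihilator_le_of_mem_support hps⟩, fun p' hp' hle => ?_⟩
    by_contra hne
    exact hlt ⟨p', hp'.1⟩ (lt_of_le_not_ge hle hne) N'
      (Module.mem_support_iff_of_finite.2 hp'.2)
  have hass := Module.associatedPrimes.minimalPrimes_annihilator_subset_associatedPrimes R _ hmin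
  obtain ⟨-, e, he⟩ := isAssociatedPrime_iff.1 hass
  have hmem (r : R) : r ∈ p.asIdeal ↔ r • e = 0 := by
    rw [he, Submodule.mem_colon_singleton, Submodule.mem_bot]
  obtain ⟨e', he'⟩ := exists_comp_eq_of_smul_eq_zero (N := N') hx e ((hmem x).1 hxp)
  obtain ⟨r, hr, hre⟩ := Module.notMem_support_iff'.1 hq e'
  refine hr ((hmem r).2 ?_)
  rw [← he', ← Ext.comp_smul, hre, Ext.comp_zero]

/-- Primary vanishing in a degree bounding the height gives vanishing. -/
lemma PrimaryVanishing.notMem_support_of_height_le {p : PrimeSpectrum R} {j : ℕ}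
    (hp : p.asIdeal.height ≤ j) (h : PrimaryVanishing Y p j)
    (N : ModuleCat.{u} B) [Module.Finite B N] : p ∉ Module.support R (Ext N Y j) := by
  induction j generalizing p N with
  | zero =>
    refine h.notMem_support (fun p' hp' => ?_) N
    have := Ideal.height_add_one_le_of_lt_of_isPrime
      (PrimeSpectrum.asIdeal_lt_asIdeal p' p |>.2 hp')
    simpa using this.trans hp
  | succ i ih =>
    refine h.notMem_support (fun p' hp' N' _ => ?_) N
    have : IsNoetherianRing B := IsNoetherianRing.of_finite R B
    have : WellFoundedGT (PrimeSpectrum R) :=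
      ⟨InvImage.wf PrimeSpectrum.asIdeal (wellFounded_gt (α := Ideal R))⟩
    obtain ⟨p₁, hle, hcov⟩ := exists_le_covBy_of_lt hp'
    have hht := Ideal.height_add_one_le_of_lt_of_isPrime
      (PrimeSpectrum.asIdeal_lt_asIdeal p₁ p |>.2 hcov.lt)
    have hht' : p₁.asIdeal.height ≤ i := by
      have := hht.trans hp
      rw [Nat.cast_succ] at this
      exact (ENat.add_le_add_iff_right ENat.one_ne_top).1 this
    exact mt (Module.mem_support_mono hle)
      (notMem_support_ext_succ (fun N'' _ => ih hht' (h.of_covBy hcov) N'') N')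

/-- Over a local base, vanishing for modules killed by a power of the maximal ideal in a degree
bounding the dimension gives vanishing from that degree on. -/
lemma PrimaryVanishing.subsingleton_ext [IsLocalRing R] {n : ℕ}
    (hn : ringKrullDim R ≤ (n : WithBot ℕ∞))
    (h : PrimaryVanishing Y (IsLocalRing.closedPoint R) n) {i : ℕ} (hi : n ≤ i)
    (N : ModuleCat.{u} B) [Module.Finite B N] : Subsingleton (Ext N Y i) := by
  have : IsNoetherianRing B := IsNoetherianRing.of_finite R B
  induction i, hi using Nat.le_induction generalizing N with
  | base =>
    have hht : (IsLocalRing.closedPoint R).asIdeal.height ≤ n := by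
      have := IsLocalRing.maximalIdeal_height_eq_ringKrullDim (R := R)
      rw [← this] at hn
      exact_mod_cast hn
    rw [← Module.support_eq_empty_iff (R := R), Set.eq_empty_iff_forall_notMem]
    intro p hp
    exact h.notMem_support_of_height_le hht N
      (Module.mem_support_mono (IsLocalRing.le_maximalIdeal p.2.ne_top) hp)
  | succ i _ ih => exact subsingleton_ext_succ (fun N _ => ih N) N

end finite

section semisimple

variable [IsLocalRing R] [Module.Finite R B]

/-- The maximal ideal of the base kills the simple modules over a finite algebra. -/
lemma maximalIdeal_smul_eq_zero_of_isSimpleModule {S : ModuleCat.{u} B} [IsSimpleModule B S]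
    {r : R} (hr : r ∈ IsLocalRing.maximalIdeal R) (x : S) : algebraMap R B r • x = 0 := by
  have : Module.Finite R S := Module.Finite.trans B S
  have : Nontrivial S := IsSimpleModule.nontrivial B S
  rcases eq_bot_or_eq_top (mulRange r S) with h | h
  · exact (Submodule.mem_bot B).1 (h ▸ ⟨x, rfl⟩ : algebraMap R B r • x ∈ (⊥ : Submodule B S))
  · refine absurd ?_ (Submodule.top_ne_pointwise_smul_of_mem_jacobson_annihilator (M := S)
      (IsLocalRing.maximalIdeal_le_jacobson _ hr))
    refine Submodule.ext fun y => ⟨fun _ => ?_, fun _ => trivial⟩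
    obtain ⟨z, hz⟩ : y ∈ mulRange r S := h ▸ trivial
    rw [← hz]
    exact Submodule.smul_mem_pointwise_smul z r ⊤ trivial

/-- A finite module killed by the maximal ideal of the base is Artinian. -/
lemma isArtinian_of_maximalIdeal_le {N : ModuleCat.{u} B} [Module.Finite B N]
    (h : IsLocalRing.maximalIdeal R ≤ baseAnnihilator R N) : IsArtinian B N := by
  have : Module.Finite R N := Module.Finite.trans B N
  have ht : Module.IsTorsionBySet R N (IsLocalRing.maximalIdeal R) := fun x r => h r.2 x
  let : Module (R ⧸ IsLocalRing.maximalIdeal R) N := ht.module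
  let : Field (R ⧸ IsLocalRing.maximalIdeal R) := Ideal.Quotient.field _
  have : IsScalarTower R (R ⧸ IsLocalRing.maximalIdeal R) N := ht.isScalarTower
  have : Module.Finite (R ⧸ IsLocalRing.maximalIdeal R) N :=
    Module.Finite.of_restrictScalars_finite R _ _
  have : IsArtinian (R ⧸ IsLocalRing.maximalIdeal R) N := inferInstance
  have : IsArtinian R N := isArtinian_of_surjective_algebraMap
    (S := R) (R := R ⧸ IsLocalRing.maximalIdeal R) Ideal.Quotient.mk_surjective
  exact isArtinian_of_tower R this

variable (R B) in
include R in
lemma isSemisimpleModule_quotient_jacobson :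
    IsSemisimpleModule B (B ⧸ Module.jacobson B B) := by
  have hm : IsLocalRing.maximalIdeal R ≤
      baseAnnihilator R (ModuleCat.of B (B ⧸ Module.jacobson B B)) := by
    refine fun r hr => mem_baseAnnihilator_quotient (N := ModuleCat.of B B).2 fun x => ?_
    refine Submodule.mem_sInf.2 fun (J : Submodule B B) hJ => ?_
    have : IsSimpleModule B (ModuleCat.of B (B ⧸ J)) := isSimpleModule_iff_isCoatom.2 hJ
    exact (Submodule.Quotient.mk_eq_zero J).1
      (maximalIdeal_smul_eq_zero_of_isSimpleModule (S := ModuleCat.of B (B ⧸ J)) hr (J.mkQ x))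
  have : IsArtinian B (B ⧸ Module.jacobson B B) :=
    isArtinian_of_maximalIdeal_le (N := ModuleCat.of B (B ⧸ Module.jacobson B B)) hm
  exact (IsArtinian.isSemisimpleModule_iff_jacobson B _).2 (Module.jacobson_quotient_jacobson B B)

variable (R) in
include R in
lemma subsingleton_ext_of_isSimpleModule {Y : ModuleCat.{u} B} {j : ℕ}
    (h : Subsingleton (Ext (ModuleCat.of B (B ⧸ Module.jacobson B B)) Y j))
    (S : ModuleCat.{u} B) [IsSimpleModule B S] : Subsingleton (Ext S Y j) := by
  obtain ⟨hS, hsurj⟩ := isSimpleModule_iff_toSpanSingleton_surjective.1 ‹IsSimpleModule B S›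
  obtain ⟨x, hx⟩ := exists_ne (0 : S)
  have hle : Module.jacobson B B ≤ LinearMap.ker (LinearMap.toSpanSingleton B S x) := by
    refine (Module.le_comap_jacobson (LinearMap.toSpanSingleton B S x)).trans ?_
    rw [IsSemisimpleModule.jacobson_eq_bot]
    rfl
  let f : (B ⧸ Module.jacobson B B) →ₗ[B] S := Submodule.liftQ _ _ hle
  have hf : Function.Surjective f := fun y => by
    obtain ⟨b, hb⟩ := hsurj x hx y
    exact ⟨Submodule.mkQ _ b, hb⟩
  have := isSemisimpleModule_quotient_jacobson R B
  obtain ⟨g, hg⟩ := IsSemisimpleModule.lifting_property f hf LinearMap.id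
  refine subsingleton_of_forall_eq 0 fun e => ?_
  have h1 : e = (Ext.mk₀ (ModuleCat.ofHom g)).comp
      ((Ext.mk₀ (ModuleCat.ofHom f)).comp e (zero_add j)) (zero_add j) := by
    rw [← Ext.comp_assoc_of_second_deg_zero, Ext.mk₀_comp_mk₀, ← ModuleCat.ofHom_comp, hg]
    exact (Ext.mk₀_id_comp e).symm
  rw [h1, Subsingleton.elim ((Ext.mk₀ (ModuleCat.ofHom f)).comp e _) 0, Ext.comp_zero]

variable (R) in
include R in
lemma subsingleton_ext_of_isFiniteLength {Y : ModuleCat.{u} B} {j : ℕ}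
    (h : Subsingleton (Ext (ModuleCat.of B (B ⧸ Module.jacobson B B)) Y j))
    {N : Type u} [AddCommGroup N] [Module B N] (hN : IsFiniteLength B N) :
    Subsingleton (Ext (ModuleCat.of B N) Y j) := by
  induction hN with
  | @of_subsingleton M _ _ _ =>
    refine subsingleton_of_forall_eq 0 fun e => ?_
    have h0 : 𝟙 (ModuleCat.of B M) = 0 := by
      ext x
      exact Subsingleton.elim (α := M) _ _
    rw [← Ext.mk₀_id_comp e, h0, Ext.mk₀_zero, Ext.zero_comp]
  | @of_simple_quotient M _ _ P hs _ ih =>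
    have : IsSimpleModule B (ModuleCat.of B (M ⧸ P)) := hs
    exact subsingleton_ext_of_shortExact (shortExact_submodule (N := ModuleCat.of B M) P) Y ih
      (subsingleton_ext_of_isSimpleModule R h (ModuleCat.of B (M ⧸ P)))

end semisimple

/-- The elements of `N` killed by an ideal of `R`. -/
def torsionSubmodule (I : Ideal R) (N : ModuleCat.{u} B) : Submodule B N :=
  ⨅ r ∈ I, LinearMap.ker (r • 𝟙 N : N ⟶ N).hom

lemma mem_torsionSubmodule {I : Ideal R} {N : ModuleCat.{u} B} {x : N} :
    x ∈ torsionSubmodule I N ↔ ∀ r ∈ I, algebraMap R B r • x = 0 := by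
  simp only [torsionSubmodule, Submodule.mem_iInf]
  rfl

section noetherian

variable [IsLocalRing R] [IsNoetherianRing R] [Module.Finite R B]

/-- Vanishing of Ext for the semisimple quotient gives vanishing for the finite modules killed
by a power of the maximal ideal of the base. -/
lemma subsingleton_ext_of_maximalIdeal_pow_le {Y : ModuleCat.{u} B} {j : ℕ}
    (h : Subsingleton (Ext (ModuleCat.of B (B ⧸ Module.jacobson B B)) Y j))
    (N : ModuleCat.{u} B) [Module.Finite B N] {k : ℕ}
    (hk : IsLocalRing.maximalIdeal R ^ k ≤ baseAnnihilator R N) : Subsingleton (Ext N Y j) := by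
  have : IsNoetherianRing B := IsNoetherianRing.of_finite R B
  have key (N : ModuleCat.{u} B) [Module.Finite B N]
      (hN : IsLocalRing.maximalIdeal R ≤ baseAnnihilator R N) : Subsingleton (Ext N Y j) :=
    subsingleton_ext_of_isFiniteLength R h (N := N)
      (isFiniteLength_iff_isNoetherian_isArtinian.2
        ⟨inferInstance, isArtinian_of_maximalIdeal_le hN⟩)
  induction k generalizing N with
  | zero =>
    exact key N (le_top.trans ((Ideal.one_eq_top (R := R)).ge.trans ((pow_zero _).ge.trans hk)))
  | succ k ih =>
    let P := torsionSubmodule (IsLocalRing.maximalIdeal R) N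
    refine subsingleton_ext_of_shortExact (shortExact_submodule P) Y
      (key (ModuleCat.of B P) fun r hr x => Subtype.ext (mem_torsionSubmodule.1 x.2 r hr))
      (ih (ModuleCat.of B (N ⧸ P)) fun y hy => mem_baseAnnihilator_quotient.2 fun x =>
        mem_torsionSubmodule.2 fun r hr => ?_)
    rw [← mul_smul, ← map_mul]
    exact hk (pow_succ' (IsLocalRing.maximalIdeal R) k ▸ Ideal.mul_mem_mul hr hy) x

/-- The vanishing theorem for the Yoneda Ext groups. -/
theorem subsingleton_ext_of_le {Y : ModuleCat.{u} B} [Module.Finite B Y] {n : ℕ}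
    (hn : ringKrullDim R ≤ (n : WithBot ℕ∞))
    (h : Subsingleton (Ext (ModuleCat.of B (B ⧸ Module.jacobson B B)) Y n)) {i : ℕ} (hi : n ≤ i)
    (N : ModuleCat.{u} B) [Module.Finite B N] : Subsingleton (Ext N Y i) := by
  refine PrimaryVanishing.subsingleton_ext (R := R) hn (fun N _ k hk => ?_) hi N
  have := subsingleton_ext_of_maximalIdeal_pow_le h N hk
  rw [Module.support_eq_empty]
  exact Set.notMem_empty _

end noetherian

lemma isUnit_one_add_mul_of_swap {A : Type u} [Ring A] {x y : A} (h : IsUnit (1 + x * y)) :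
    IsUnit (1 + y * x) := by
  obtain ⟨u, hu⟩ := h
  have h1 : (1 + x * y) * ↑u⁻¹ = 1 := hu ▸ u.mul_inv
  have h2 : ↑u⁻¹ * (1 + x * y) = 1 := hu ▸ u.inv_mul
  refine ⟨⟨1 + y * x, 1 - y * ↑u⁻¹ * x, ?_, ?_⟩, rfl⟩
  · calc (1 + y * x) * (1 - y * ↑u⁻¹ * x)
      _ = 1 + y * (1 - (1 + x * y) * ↑u⁻¹) * x := by noncomm_ring
      _ = 1 := by rw [h1]; simp
  · calc (1 - y * ↑u⁻¹ * x) * (1 + y * x)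
      _ = 1 + y * (1 - ↑u⁻¹ * (1 + x * y)) * x := by noncomm_ring
      _ = 1 := by rw [h2]; simp

lemma mem_ringJacobson_iff {A : Type u} [Ring A] {x : A} :
    x ∈ Ring.jacobson A ↔ ∀ y, IsUnit (1 + y * x) := by
  rw [← Ideal.jacobson_bot, Ideal.mem_jacobson_iff]
  have key (h : ∀ y : A, ∃ z, z * y * x + z - 1 ∈ (⊥ : Ideal A)) (y : A) :
      ∃ z, z * (1 + y * x) = 1 := by
    obtain ⟨z, hz⟩ := h y
    refine ⟨z, ?_⟩
    rw [Ideal.mem_bot, sub_eq_zero] at hz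
    rw [mul_add, mul_one, ← mul_assoc, add_comm, hz]
  refine ⟨fun h y => ?_, fun h y => ?_⟩
  · obtain ⟨z, hz⟩ := key h y
    obtain ⟨w, hw⟩ := key h (-(z * y))
    have hz' : 1 + -(z * y) * x = z := by
      rw [mul_add, mul_one, ← mul_assoc] at hz
      rw [neg_mul, ← sub_eq_add_neg, sub_eq_iff_eq_add, hz]
    rw [hz'] at hw
    have hwy : w = 1 + y * x := left_inv_eq_right_inv hw hz
    exact ⟨⟨1 + y * x, z, hwy ▸ hw, hz⟩, rfl⟩
  · obtain ⟨u, hu⟩ := h y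
    refine ⟨↑u⁻¹, ?_⟩
    rw [Ideal.mem_bot, sub_eq_zero, ← u.inv_mul, hu, mul_add, mul_one, ← mul_assoc, add_comm]

lemma radRight_eq_jacobson (A : Type u) [Ring A] : radRight A = Module.jacobson Aᵐᵒᵖ Aᵐᵒᵖ := by
  ext x
  have h1 : x ∈ radRight A ↔ x.unop ∈ Ring.jacobson A := by
    change x.unop ∈ TwoSidedIdeal.jacobson (⊥ : TwoSidedIdeal A) ↔ _
    rw [← Ideal.jacobson_bot, TwoSidedIdeal.mem_jacobson_iff, Ideal.mem_jacobson_iff]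
    rfl
  change _ ↔ x ∈ Ring.jacobson Aᵐᵒᵖ
  rw [h1, mem_ringJacobson_iff, mem_ringJacobson_iff, MulOpposite.op_surjective.forall]
  refine forall_congr' fun y => ?_
  rw [← isUnit_unop]
  exact ⟨fun h => isUnit_one_add_mul_of_swap h, fun h => isUnit_one_add_mul_of_swap h⟩

section comparison

variable {X : ModuleCat.{u} B} (P : ProjectiveResolution X)
  (Y : ModuleCat.{u} B)

lemma subsingleton_extGroup_iff_exists (n : ℕ) :
    Subsingleton (((_root_.Ext ℤ (ModuleCat.{u} B) n).obj (Opposite.op X)).obj Y) ↔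
      ∀ f : P.complex.X n ⟶ Y, P.complex.d (n + 1) n ≫ f = 0 →
        ∃ g : P.complex.X ((ComplexShape.up ℕ).prev n) ⟶ Y, P.complex.d n _ ≫ g = f := by
  rw [← ModuleCat.isZero_iff_subsingleton, (P.isoExt (R := ℤ) n Y).isZero_iff,
    ← HomologicalComplex.exactAt_iff_isZero_homology,
    HomologicalComplex.exactAt_iff' _ _ n (n + 1) rfl (by simp),
    ShortComplex.moduleCat_exact_iff]
  rfl

lemma subsingleton_abelianExt_iff_exists (n : ℕ) :
    Subsingleton (Ext X Y n) ↔
      ∀ f : P.complex.X n ⟶ Y, P.complex.d (n + 1) n ≫ f = 0 →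
        ∃ g : P.complex.X ((ComplexShape.up ℕ).prev n) ⟶ Y, P.complex.d n _ ≫ g = f := by
  cases n with
  | zero =>
    have h0 : P.complex.d 0 ((ComplexShape.up ℕ).prev 0) = 0 := P.complex.shape _ _ (by simp)
    rw [Ext.addEquiv₀.subsingleton_congr, h0]
    refine ⟨fun _ f hf => ⟨0, ?_⟩, fun h => subsingleton_of_forall_eq 0 fun g => ?_⟩
    · have : P.exact₀.desc f hf = 0 := Subsingleton.elim (α := X ⟶ Y) _ _
      rw [← P.exact₀.g_desc f hf, this, Limits.comp_zero, Limits.comp_zero]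
    · change ((ChainComplex.single₀ (ModuleCat.{u} B)).obj X).X 0 ⟶ Y at g
      obtain ⟨_, hf⟩ := h (P.π.f 0 ≫ g)
        (by rw [← Category.assoc, P.complex_d_comp_π_f_zero, Limits.zero_comp])
      exact (cancel_epi (P.π.f 0)).1 (by rw [← hf, Limits.zero_comp]; exact Limits.comp_zero.symm)
  | succ p =>
    rw [CochainComplex.prev_nat_succ]
    refine ⟨fun _ f hf => (P.extMk_eq_zero_iff f _ rfl hf p rfl).1 (Subsingleton.elim _ _),
      fun h => subsingleton_of_forall_eq 0 fun α => ?_⟩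
    obtain ⟨f, hf, rfl⟩ := P.extMk_surjective α _ rfl
    exact (P.extMk_eq_zero_iff f _ rfl hf p rfl).2 (h f hf)

/-- The two versions of Ext in Mathlib vanish simultaneously. -/
lemma subsingleton_extGroup_iff (X Y : ModuleCat.{u} B) (n : ℕ) :
    Subsingleton (((_root_.Ext ℤ (ModuleCat.{u} B) n).obj (Opposite.op X)).obj Y) ↔
      Subsingleton (Ext X Y n) :=
  (subsingleton_extGroup_iff_exists (projectiveResolution X) Y n).trans
    (subsingleton_abelianExt_iff_exists (projectiveResolution X) Y n).symm

end comparison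

end NoetherAlgebra

/-- Let `R` be a commutative noetherian local ring and `A` a Noether
`R`-algebra.  Let `M` be a finitely generated right `A`-module, and assume
`Ext^n_A(A/rad A, M) = 0` for some `n ≥ dim R`.  Then `Ext^i_A(A/rad A, M) = 0` for every
`i ≥ n`. -/
theorem ext_jacobson_vanishing_of_vanishing
    (R : Type u) [CommRing R] [IsNoetherianRing R] [IsLocalRing R]
    (A : Type u) [Ring A] [Algebra R A] [Module.Finite R A]
    (M : Type u) [AddCommGroup M] [Module Aᵐᵒᵖ M] [Module.Finite Aᵐᵒᵖ M]
    (n : ℕ) (hn : ringKrullDim R ≤ (n : WithBot ℕ∞))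
    (hvanish : Subsingleton
      (extGrp Aᵐᵒᵖ n (ModuleCat.of Aᵐᵒᵖ (modRad A)) (ModuleCat.of Aᵐᵒᵖ M))) :
    ∀ i : ℕ, n ≤ i → Subsingleton
      (extGrp Aᵐᵒᵖ i (ModuleCat.of Aᵐᵒᵖ (modRad A)) (ModuleCat.of Aᵐᵒᵖ M)) := by
  intro i hi
  rw [NoetherAlgebra.subsingleton_extGroup_iff] at hvanish ⊢
  refine NoetherAlgebra.subsingleton_ext_of_le (R := R) hn ?_ hi _
  rw [← NoetherAlgebra.radRight_eq_jacobson]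
  exact hvanish
end

section
/- Let R be a commutative noetherian local ring that is complete with respect to its maximal-ideal-adic topology, and let A be a Noether R-algebra. Then every projective right A-module is a direct sum of finitely generated indecomposable projective right A-modules; that is, for every projective right A-module F there exist a family (P_i)_{i ∈ I} of finitely generated indecomposable projective right A-modules and an isomorphism F ≅ ⊕_{i ∈ I} P_i. -/
universe v u

/-- A module is indecomposable if it is nonzero and is not the (internal) direct sum of two
nonzero submodules. -/
def IsIndecomposableModule (B : Type*) [Ring B] (M : Type*) [AddCommGroup M]
    [Module B M] : Prop :=
  Nontrivial M ∧ ∀ P Q : Submodule B M, IsCompl P Q → P = ⊥ ∨ Q = ⊥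

open Classical

/-- A finite module over a complete noetherian local ring is complete. -/
theorem IsAdicComplete.of_finite {R : Type*} [CommRing R] [IsNoetherianRing R] [IsLocalRing R]
    [IsAdicComplete (IsLocalRing.maximalIdeal R) R]
    (M : Type*) [AddCommGroup M] [Module R M] [Module.Finite R M] :
    IsAdicComplete (IsLocalRing.maximalIdeal R) M := by
  have hpre : IsPrecomplete (IsLocalRing.maximalIdeal R) M := by
    rw [← AdicCompletion.of_surjective_iff]
    intro y
    obtain ⟨z, rfl⟩ := AdicCompletion.ofTensorProduct_surjective_of_finite
      (IsLocalRing.maximalIdeal R) M y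
    induction z with
    | zero => exact ⟨0, by simp⟩
    | tmul r x =>
      obtain ⟨r, rfl⟩ := AdicCompletion.of_surjective (IsLocalRing.maximalIdeal R) R r
      refine ⟨r • x, ?_⟩
      rw [AdicCompletion.ofTensorProduct_tmul, map_smul]
      ext n
      rfl
    | add a b ha hb =>
      obtain ⟨a', ha⟩ := ha
      obtain ⟨b', hb⟩ := hb
      exact ⟨a' + b', by rw [map_add, map_add, ha, hb]⟩
  exact { toIsPrecomplete := hpre, toIsHausdorff := inferInstance }

/-- Idempotents lift modulo the ideal of a henselian pair. -/
theorem HenselianRing.exists_isIdempotentElem_sub_mem {C : Type*} [CommRing C] (I : Ideal C)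
    [HenselianRing C I] (b : C) (hb : b * b - b ∈ I) :
    ∃ f : C, IsIdempotentElem f ∧ f - b ∈ I := by
  have hm : (Polynomial.X ^ 2 - Polynomial.X : Polynomial C).Monic := by
    nontriviality C
    monicity!
  obtain ⟨f, hf, hfb⟩ := HenselianRing.is_henselian (I := I)
    (Polynomial.X ^ 2 - Polynomial.X : Polynomial C) hm b
    (by simpa [pow_two] using hb) (by
      refine IsUnit.of_mul_eq_one (Ideal.Quotient.mk I (2 * b - 1)) ?_
      rw [← map_mul, ← map_one (Ideal.Quotient.mk I), Ideal.Quotient.eq]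
      have : Polynomial.eval b (Polynomial.derivative (Polynomial.X ^ 2 - Polynomial.X))
          * (2 * b - 1) - 1 = 4 * (b * b - b) := by
        simp; ring
      rw [this]
      exact I.mul_mem_left _ hb)
  refine ⟨f, ?_, hfb⟩
  simpa [IsIdempotentElem, Polynomial.IsRoot, pow_two, sub_eq_zero] using hf

theorem exists_mul_mul_eq_and_one_sub_mul {C : Type*} [CommRing C] (I : Ideal C)
    [HenselianRing C I] [IsArtinianRing (C ⧸ I)] (a : C) :
    ∃ s w : C, s * a * s = s ∧ 1 - s * a = w * (1 - a) := by
  have hjac : ∀ z ∈ I, IsUnit (1 - z) := fun z hz => by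
    have := Ideal.mem_jacobson_bot.mp (HenselianRing.jac (I := I) hz) (-1)
    simpa [sub_eq_add_neg, add_comm] using this
  obtain ⟨n, c, hc⟩ : ∃ n : ℕ, ∃ c : C, a ^ (n + 1) - c * a ^ (2 * (n + 1)) ∈ I := by
    obtain ⟨n, y, hy⟩ := IsArtinian.exists_pow_succ_smul_dvd (Ideal.Quotient.mk I a)
      (1 : C ⧸ I)
    obtain ⟨y, rfl⟩ := Ideal.Quotient.mk_surjective y
    set x := Ideal.Quotient.mk I a
    set y' := Ideal.Quotient.mk I y
    have hy' : x ^ n * (x * y') = x ^ n := by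
      rw [← mul_assoc, ← pow_succ]
      simpa using hy
    have hk : ∀ k : ℕ, x ^ n * (x * y') ^ k = x ^ n := by
      intro k
      induction k with
      | zero => simp
      | succ k ih => rw [pow_succ, ← mul_assoc, ih, hy']
    refine ⟨n, y ^ (n + 1), ?_⟩
    rw [← Ideal.Quotient.eq]
    simp only [map_mul, map_pow]
    change x ^ (n + 1) = y' ^ (n + 1) * x ^ (2 * (n + 1))
    linear_combination (-x) * hk (n + 1)
  obtain ⟨f, hf, hfb⟩ := HenselianRing.exists_isIdempotentElem_sub_mem I (c * a ^ (n + 1)) (by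
    have : c * a ^ (n + 1) * (c * a ^ (n + 1)) - c * a ^ (n + 1)
      = -c * (a ^ (n + 1) - c * a ^ (2 * (n + 1))) := by ring
    rw [this]
    exact I.mul_mem_left _ hc)
  obtain ⟨g, hg⟩ := (Commute.all (1 : C) a).sub_dvd_pow_sub_pow (n + 1)
  rw [one_pow] at hg
  obtain ⟨i₁, hi₁⟩ := hjac (f - c * a ^ (n + 1)) hfb
  obtain ⟨i₂, hi₂⟩ := hjac ((1 - f) * a ^ (n + 1)) (by
    have : (1 - f) * a ^ (n + 1) = (a ^ (n + 1) - c * a ^ (2 * (n + 1)))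
      - a ^ (n + 1) * (f - c * a ^ (n + 1)) := by ring
    rw [this]
    exact I.sub_mem hc (I.mul_mem_left _ hfb))
  have h₁ := i₁.inv_mul
  have h₂ := i₂.inv_mul
  rw [hi₁] at h₁
  rw [hi₂] at h₂
  have hf' : f * f = f := hf
  set j₁ : C := ↑i₁⁻¹
  set j₂ : C := ↑i₂⁻¹
  have hsa : f * j₁ * c * a ^ n * a = f := by
    linear_combination f * h₁ + j₁ * hf'
  refine ⟨f * j₁ * c * a ^ n, (1 - f) * j₂ * g, ?_, ?_⟩
  · rw [hsa]
    linear_combination j₁ * c * a ^ n * hf'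
  · rw [hsa]
    have : (1 - f) * j₂ * g * (1 - a) = (1 - f) * j₂ * (1 - a ^ (n + 1)) := by rw [hg]; ring
    rw [this]
    linear_combination (-(1 - f)) * h₂ - j₂ * a ^ (n+1) * hf'

/-- A finite algebra over a complete noetherian local ring is an exchange ring. -/
theorem exists_mul_mul_eq_and_one_sub_mul_of_finite {R : Type u} [CommRing R]
    [IsNoetherianRing R] [IsLocalRing R] [IsAdicComplete (IsLocalRing.maximalIdeal R) R]
    {E : Type*} [Ring E] [Algebra R E] [Module.Finite R E] (a : E) :
    ∃ s w : E, s * a * s = s ∧ 1 - s * a = w * (1 - a) := by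
  obtain ⟨p, hp, hpa⟩ := IsIntegral.of_finite R a
  have := hp.finite_adjoinRoot
  set I := (IsLocalRing.maximalIdeal R).map (algebraMap R (AdjoinRoot p)) with hI
  have : IsAdicComplete I (AdjoinRoot p) := by
    have := IsAdicComplete.of_finite (R := R) (AdjoinRoot p)
    exact { toIsHausdorff := IsHausdorff.map_algebraMap_iff.mpr inferInstance
            toIsPrecomplete := IsPrecomplete.map_algebraMap_iff.mpr inferInstance }
  have : IsArtinianRing (AdjoinRoot p ⧸ I) :=
    letI := Ideal.Quotient.field (IsLocalRing.maximalIdeal R)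
    IsArtinianRing.of_finite (R ⧸ IsLocalRing.maximalIdeal R) _
  obtain ⟨s, w, h₁, h₂⟩ := exists_mul_mul_eq_and_one_sub_mul I (AdjoinRoot.root p)
  obtain ⟨s, rfl⟩ := AdjoinRoot.mk_surjective s
  obtain ⟨w, rfl⟩ := AdjoinRoot.mk_surjective w
  have key : ∀ q : Polynomial R, AdjoinRoot.mk p q = 0 → Polynomial.aeval a q = 0 := by
    intro q hq
    obtain ⟨r, rfl⟩ := AdjoinRoot.mk_eq_zero.mp hq
    rw [map_mul, Polynomial.aeval_def, hpa, zero_mul]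
  refine ⟨Polynomial.aeval a s, Polynomial.aeval a w, ?_, ?_⟩
  · have := key (s * Polynomial.X * s - s) (by simpa [sub_eq_zero] using h₁)
    simpa [sub_eq_zero] using this
  · have := key (1 - s * Polynomial.X - w * (1 - Polynomial.X)) (by simpa [sub_eq_zero] using h₂)
    simpa [sub_eq_zero] using this

theorem Module.Projective.exists_dual_basis {B : Type*} [Ring B] {F : Type*} [AddCommGroup F]
    [Module B F] [Module.Projective B F] (x : F) :
    ∃ (t : Finset F) (u : F →ₗ[B] (t → B)) (v : (t → B) →ₗ[B] F), v (u x) = x := by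
  obtain ⟨j, hj⟩ := Module.projective_def.mp ‹Module.Projective B F›
  refine ⟨(j x).support, LinearMap.pi fun k => Finsupp.lapply (k : F) ∘ₗ j,
    ∑ k : (j x).support, (LinearMap.toSpanSingleton B F (k : F)) ∘ₗ LinearMap.proj k, ?_⟩
  conv_rhs => rw [← hj x]
  rw [Finsupp.linearCombination_apply, Finsupp.sum]
  simp only [LinearMap.sum_apply, LinearMap.comp_apply, LinearMap.proj_apply, LinearMap.pi_apply,
    Finsupp.lapply_apply, LinearMap.toSpanSingleton_apply]
  exact Finset.sum_coe_sort (j x).support fun k => j x k • k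

/-- Every element of a direct summand `e F` of a projective module `F` lies in a finitely generated
direct summand of `e F`. -/
theorem exists_idempotent_fg_range_apply_eq {R : Type u} [CommRing R] [IsNoetherianRing R]
    [IsLocalRing R] [IsAdicComplete (IsLocalRing.maximalIdeal R) R]
    {B : Type*} [Ring B] [Algebra R B] [Module.Finite R B]
    {F : Type*} [AddCommGroup F] [Module B F] [Module.Projective B F]
    (e : Module.End B F) (he : e * e = e) (x : F) :
    ∃ h : Module.End B F, h * h = h ∧ e * h = h ∧ h * e = h ∧ h (e x) = e x ∧
      (LinearMap.range h).FG := by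
  have : IsNoetherianRing B := IsNoetherianRing.of_finite R B
  obtain ⟨t, u, v, huv⟩ := Module.Projective.exists_dual_basis (B := B) (e x)
  have : Module.Finite R (Module.End B (t → B)) :=
    Module.Finite.equiv ((Pi.basisFun B t).constr (M' := t → B) R)
  have hee : ∀ y, e (e y) = e y := fun y => LinearMap.congr_fun he y
  obtain ⟨s, w, hs, hw⟩ := exists_mul_mul_eq_and_one_sub_mul_of_finite (R := R)
    (E := Module.End B (t → B)) (u ∘ₗ e ∘ₗ v)
  have hs' : ∀ y, s (u (e (v (s y)))) = s y := fun y => LinearMap.congr_fun hs y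
  have hw' : ∀ y, y - s (u (e (v y))) = w (y - u (e (v y))) := fun y => LinearMap.congr_fun hw y
  refine ⟨e ∘ₗ v ∘ₗ s ∘ₗ u ∘ₗ e, ?_, ?_, ?_, ?_, ?_⟩
  · ext y
    simp [hee, hs']
  · ext y
    simp [hee]
  · ext y
    simp [hee]
  · have := hw' (u (e x))
    rw [huv, hee, sub_self, map_zero, sub_eq_zero] at this
    simp [hee, ← this, huv]
  · have hle : LinearMap.range (e ∘ₗ v ∘ₗ s ∘ₗ u ∘ₗ e) ≤ LinearMap.range (e ∘ₗ v) := by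
      rintro _ ⟨y, rfl⟩
      exact ⟨s (u (e y)), rfl⟩
    have : IsNoetherian B (LinearMap.range (e ∘ₗ v)) :=
      isNoetherian_of_isNoetherianRing_of_finite _ _
    exact Submodule.FG.of_le_of_isNoetherian hle

/-- An element of a complete lattice that is the supremum of an independent set of elements
satisfying `Φ`. -/
def IsIndepSup {α : Type*} [CompleteLattice α] (Φ : α → Prop) (a : α) : Prop :=
  ∃ s : Set α, sSupIndep s ∧ sSup s = a ∧ ∀ b ∈ s, Φ b

theorem IsIndepSup.of_self {α : Type*} [CompleteLattice α] {Φ : α → Prop} {a : α} (h : Φ a) :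
    IsIndepSup Φ a :=
  ⟨{a}, sSupIndep_singleton a, sSup_singleton, by simpa⟩

theorem IsIndepSup.iSup {α : Type*} [CompleteLattice α] [IsModularLattice α] {Φ : α → Prop}
    {ι : Type*} {a : ι → α} (hind : iSupIndep a) (h : ∀ i, IsIndepSup Φ (a i)) :
    IsIndepSup Φ (⨆ i, a i) := by
  choose s hs hsa hΦ using h
  refine ⟨⋃ i, s i, ?_, ?_, ?_⟩
  · intro b hb
    obtain ⟨i, hi⟩ := Set.mem_iUnion.mp hb
    have h₁ : Disjoint b (sSup (s i \ {b})) := hs i hi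
    have h₂ : Disjoint (b ⊔ sSup (s i \ {b})) (⨆ (k) (_ : k ≠ i), a k) := by
      refine (hind i).mono_left ?_
      rw [← hsa i]
      exact sup_le (le_sSup hi) (sSup_le_sSup Set.sdiff_subset)
    refine (h₁.disjoint_sup_right_of_disjoint_sup_left h₂).mono_right (sSup_le ?_)
    rintro c ⟨hc, hcb⟩
    obtain ⟨k, hk⟩ := Set.mem_iUnion.mp hc
    by_cases hki : k = i
    · subst hki
      exact le_sup_of_le_left (le_sSup ⟨hk, hcb⟩)
    · refine le_sup_of_le_right (le_trans ?_ (le_iSup₂_of_le k hki le_rfl))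
      rw [← hsa k]
      exact le_sSup hk
  · rw [sSup_iUnion]
    simp only [hsa]
  · intro b hb
    obtain ⟨i, hi⟩ := Set.mem_iUnion.mp hb
    exact hΦ i b hi

theorem IsIndepSup.sup {α : Type*} [CompleteLattice α] [IsModularLattice α] {Φ : α → Prop}
    {a b : α} (hab : Disjoint a b) (ha : IsIndepSup Φ a) (hb : IsIndepSup Φ b) :
    IsIndepSup Φ (a ⊔ b) := by
  rw [sup_eq_iSup]
  refine IsIndepSup.iSup ?_ (by rintro (_ | _) <;> assumption)
  rw [iSupIndep_pair (i := true) (j := false) (by simp) (by simp)]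
  exact hab

/-- A finitely generated module over a noetherian ring is a direct sum of indecomposables. -/
theorem IsIndepSup.of_fg {B : Type*} [Ring B] [IsNoetherianRing B] {F : Type*} [AddCommGroup F]
    [Module B F] {N : Submodule B F} (hN : N.FG) :
    IsIndepSup (fun P : Submodule B F => P.FG ∧ IsIndecomposableModule B P) N := by
  have : Module.Finite B N := Module.Finite.iff_fg.mpr hN
  have hwf : WellFoundedGT (Set.Iic N) := (Submodule.mapIic N).symm.toOrderEmbedding.wellFoundedGT
  suffices ∀ C : Set.Iic N, ∀ D : Submodule B F, Disjoint C.1 D → C.1 ⊔ D = N →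
      IsIndepSup (fun P : Submodule B F => P.FG ∧ IsIndecomposableModule B P) D from
    this ⟨⊥, Set.mem_Iic.mpr bot_le⟩ N disjoint_bot_left (bot_sup_eq N)
  intro C
  induction C using WellFoundedGT.induction with
  | ind C ih =>
  intro D hCD hsup
  have hDN : D ≤ N := hsup ▸ le_sup_right
  by_cases hD : Nontrivial D
  swap
  · refine ⟨∅, sSupIndep_empty, ?_, by simp⟩
    rw [sSup_empty]
    rw [Submodule.nontrivial_iff_ne_bot, not_not] at hD
    exact hD.symm
  by_cases hind : IsIndecomposableModule B D
  · exact .of_self ⟨hN.of_le hDN, hind⟩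
  simp only [IsIndecomposableModule, hD, true_and, not_forall, not_or] at hind
  obtain ⟨P, Q, hPQ, hP, hQ⟩ := hind
  have hsplit : P.map D.subtype ⊔ Q.map D.subtype = D := by
    rw [← Submodule.map_sup, hPQ.sup_eq_top, Submodule.map_subtype_top]
  have hdisj : Disjoint (P.map D.subtype) (Q.map D.subtype) :=
    (Submodule.disjoint_map D.injective_subtype hPQ.disjoint)
  have hP' : P.map D.subtype ≠ ⊥ := by
    rw [← Submodule.map_bot D.subtype]
    exact (Submodule.map_injective_of_injective D.injective_subtype).ne hP
  have hQ' : Q.map D.subtype ≠ ⊥ := by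
    rw [← Submodule.map_bot D.subtype]
    exact (Submodule.map_injective_of_injective D.injective_subtype).ne hQ
  generalize P.map D.subtype = P' at *
  generalize Q.map D.subtype = Q' at *
  have step : ∀ P' Q' : Submodule B F, P' ⊔ Q' = D → Disjoint P' Q' → P' ≠ ⊥ →
      IsIndepSup (fun P : Submodule B F => P.FG ∧ IsIndecomposableModule B P) Q' := by
    intro P' Q' hsplit hdisj hP'
    have hP'D : P' ≤ D := hsplit ▸ le_sup_left
    refine ih ⟨C.1 ⊔ P', sup_le C.2 (hP'D.trans hDN)⟩ ?_ Q' ?_ ?_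
    · refine lt_of_le_of_ne (Subtype.coe_le_coe.mp le_sup_left) fun h => hP' ?_
      have : C.1 = C.1 ⊔ P' := congrArg Subtype.val h
      exact (hCD.mono_right hP'D).eq_bot_of_ge (this ▸ le_sup_right)
    · exact hdisj.disjoint_sup_left_of_disjoint_sup_right (hsplit ▸ hCD)
    · change C.1 ⊔ P' ⊔ Q' = N
      rw [sup_assoc, hsplit, hsup]
  rw [← hsplit]
  exact .sup hdisj (step Q' P' (sup_comm P' Q' ▸ hsplit) hdisj.symm hQ')
    (step P' Q' hsplit hdisj hP')

theorem IsIndepSup.of_countably_spanned {B : Type*} [Ring B] {F : Type*} [AddCommGroup F]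
    [Module B F]
    (key : ∀ e : {e : Module.End B F // e * e = e}, ∀ x : F, ∃ h : Module.End B F,
      h * h = h ∧ e * h = h ∧ h * e = h ∧ h (e.1 x) = e.1 x ∧ (LinearMap.range h).FG)
    (e : Module.End B F) (he : e * e = e) (x : ℕ → F)
    (hx : LinearMap.range e = Submodule.span B (Set.range x)) :
    IsIndepSup Submodule.FG (LinearMap.range e) := by
  choose h hh heh hhe hhx hfg using key
  let E : ℕ → {e : Module.End B F // e * e = e} := fun n =>
    Nat.rec ⟨e, he⟩ (fun n e' => ⟨e'.1 - h e' (x n), by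
      rw [sub_mul, mul_sub, mul_sub, e'.2, heh, hhe, hh, sub_self, sub_zero]⟩) n
  let d : ℕ → Module.End B F := fun n => (E n).1
  let g : ℕ → Module.End B F := fun n => h (E n) (x n)
  have hd : ∀ n, d (n + 1) = d n - g n := fun n => rfl
  have hgg : ∀ n, g n * g n = g n := fun n => hh _ _
  have hdg : ∀ n, d n * g n = g n := fun n => heh _ _
  have hgd : ∀ n, g n * d n = g n := fun n => hhe _ _
  have hdd : ∀ n k, d (n + k) * d n = d (n + k) ∧ d n * d (n + k) = d (n + k) := by
    intro n k
    induction k with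
    | zero => exact ⟨(E n).2, (E n).2⟩
    | succ k ih =>
      rw [← add_assoc, hd, sub_mul, mul_sub, ih.1, ih.2, ← hgd (n + k), mul_assoc, ih.1, hgd,
        ← hdg (n + k), ← mul_assoc, ih.2]
      exact ⟨rfl, rfl⟩
  have hlt : ∀ i k, g (i + 1 + k) * g i = 0 ∧ g i * g (i + 1 + k) = 0 := by
    intro i k
    constructor
    · rw [← hgd (i + 1 + k), ← (hdd (i + 1) k).1, mul_assoc, mul_assoc, hd, sub_mul, hdg, hgg,
        sub_self, mul_zero, mul_zero]
    · rw [← hdg (i + 1 + k), ← (hdd (i + 1) k).2, ← mul_assoc, ← mul_assoc, hd, mul_sub, hgd, hgg,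
        sub_self, zero_mul, zero_mul]
  have horth : ∀ i j, j ≠ i → g i * g j = 0 := by
    intro i j hij
    rcases lt_or_gt_of_ne hij with h | h
    · obtain ⟨k, rfl⟩ := Nat.exists_eq_add_of_le h
      exact (hlt j k).1
    · obtain ⟨k, rfl⟩ := Nat.exists_eq_add_of_le h
      exact (hlt i k).2
  have hind : iSupIndep fun n => LinearMap.range (g n) := by
    intro i
    have hker : (⨆ (j) (_ : j ≠ i), LinearMap.range (g j)) ≤ LinearMap.ker (g i) := by
      refine iSup₂_le fun j hj => ?_
      rintro _ ⟨y, rfl⟩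
      exact LinearMap.congr_fun (horth i j hj) y
    refine Disjoint.mono_right hker (Submodule.disjoint_def.mpr ?_)
    rintro _ ⟨y, rfl⟩ hy
    rw [← hgg i]
    exact hy
  have hsup : ⨆ n, LinearMap.range (g n) = LinearMap.range e := by
    apply le_antisymm
    · refine iSup_le fun n => ?_
      rintro _ ⟨y, rfl⟩
      refine ⟨g n y, ?_⟩
      have h₁ : d 0 * d n = d n := by simpa using (hdd 0 n).2
      change (d 0 * g n) y = g n y
      rw [← hdg n, ← mul_assoc, h₁]
    · have hsum : ∀ n y, e y - d n y ∈ ⨆ n, LinearMap.range (g n) := by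
        intro n y
        induction n with
        | zero =>
          rw [show d 0 = e from rfl, sub_self]
          exact zero_mem _
        | succ n ih =>
          rw [hd, LinearMap.sub_apply, sub_sub_eq_add_sub, add_sub_right_comm]
          exact add_mem ih (le_iSup (fun n => LinearMap.range (g n)) n ⟨y, rfl⟩)
      rw [hx, Submodule.span_le]
      rintro _ ⟨n, rfl⟩
      have hex : e (x n) = x n := by
        obtain ⟨y, hy⟩ : x n ∈ LinearMap.range e := hx ▸ Submodule.subset_span ⟨n, rfl⟩
        rw [← hy]
        exact LinearMap.congr_fun he y
      have hdx : d (n + 1) (x n) = 0 := by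
        rw [hd, LinearMap.sub_apply, ← hgd n]
        exact sub_eq_zero.mpr (hhx (E n) (x n)).symm
      have := hsum (n + 1) (x n)
      rwa [hdx, hex, sub_zero] at this
  rw [← hsup]
  exact .iSup hind fun n => .of_self (hfg _ _)

theorem sSupIndep.insert {α : Type*} [CompleteLattice α] [IsModularLattice α] {s : Set α} {a : α}
    (hs : sSupIndep s) (ha : Disjoint (sSup s) a) : sSupIndep (insert a s) := by
  rintro b (rfl | hb)
  · refine ha.symm.mono_right (sSup_le_sSup ?_)
    rintro c ⟨rfl | hc, hcb⟩
    exacts [absurd rfl hcb, hc]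
  · have h₁ : Disjoint (b ⊔ sSup (s \ {b})) a :=
      ha.mono_left (sup_le (le_sSup hb) (sSup_le_sSup Set.sdiff_subset))
    refine ((hs hb).disjoint_sup_right_of_disjoint_sup_left h₁).mono_right (sSup_le ?_)
    rintro c ⟨rfl | hc, hcb⟩
    exacts [le_sup_right, le_sup_of_le_left (le_sSup ⟨hc, hcb⟩)]

theorem Set.exists_countable_mem_forall_subset {α : Type*} (f : α → Set α)
    (hf : ∀ a, (f a).Countable) (a : α) :
    ∃ T : Set α, T.Countable ∧ a ∈ T ∧ ∀ b ∈ T, f b ⊆ T := by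
  let T : ℕ → Set α := fun n => Nat.rec {a} (fun _ s => ⋃ b ∈ s, f b) n
  have hT : ∀ n, (T n).Countable := by
    intro n
    induction n with
    | zero => exact Set.countable_singleton a
    | succ n ih => exact ih.biUnion fun b _ => hf b
  refine ⟨⋃ n, T n, Set.countable_iUnion hT, Set.mem_iUnion.mpr ⟨0, rfl⟩, ?_⟩
  intro b hb
  obtain ⟨n, hn⟩ := Set.mem_iUnion.mp hb
  exact (Set.subset_biUnion_of_mem (u := f) hn).trans (Set.subset_iUnion T (n + 1))

/-- **Kaplansky's theorem**: a projective module is a direct sum of countably generated direct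
summands. -/
theorem Module.Projective.isIndepSup_countably_spanned {B : Type*} [Ring B] {F : Type*}
    [AddCommGroup F] [Module B F] [Module.Projective B F] :
    IsIndepSup (fun K : Submodule B F => ∃ e : Module.End B F, e * e = e ∧
      LinearMap.range e = K ∧ ∃ x : ℕ → F, K = Submodule.span B (Set.range x)) ⊤ := by
  obtain ⟨j, hj⟩ := Module.projective_def.mp ‹Module.Projective B F›
  set Φ := fun K : Submodule B F => ∃ e : Module.End B F, e * e = e ∧
      LinearMap.range e = K ∧ ∃ x : ℕ → F, K = Submodule.span B (Set.range x)
  let supp : F → Set F := fun k => (j k).support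
  let ρ : Set F → Module.End B F := fun S => Finsupp.linearCombination B id ∘ₗ
    (Finsupp.supported B B S).subtype ∘ₗ Finsupp.restrictDom B B S ∘ₗ j
  have hρ_mem : ∀ S x, ρ S x ∈ Submodule.span B S := by
    intro S x
    have := Finsupp.mem_span_image_iff_linearCombination B (v := (id : F → F)) (s := S)
      (x := ρ S x)
    rw [Set.image_id] at this
    exact this.mpr ⟨_, (Finsupp.restrictDom B B S (j x)).2, rfl⟩
  have hρ_eq : ∀ S, (∀ k ∈ S, supp k ⊆ S) → ∀ x ∈ Submodule.span B S, ρ S x = x := by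
    intro S hS x hx
    have : Set.EqOn (ρ S) (LinearMap.id : F →ₗ[B] F) S := by
      intro k hk
      have h₁ : (Finsupp.restrictDom B B S (j k) : F →₀ B) = j k := by
        rw [Finsupp.restrictDom_apply]
        exact Finsupp.filter_eq_self_iff _ _ |>.mpr fun l hl =>
          hS k hk (Finsupp.mem_support_iff.mpr hl)
      change Finsupp.linearCombination B id (Finsupp.restrictDom B B S (j k) : F →₀ B) = k
      rw [h₁, hj k]
    exact LinearMap.eqOn_span this hx
  let 𝒵 : Set (Set F × Set (Submodule B F)) := {z | (∀ k ∈ z.1, supp k ⊆ z.1) ∧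
    sSupIndep z.2 ∧ sSup z.2 = Submodule.span B z.1 ∧ ∀ K ∈ z.2, Φ K}
  obtain ⟨⟨S, 𝒮⟩, hmax⟩ : ∃ z, Maximal (· ∈ 𝒵) z := by
    refine zorn_le₀ 𝒵 fun c hc hchain => ?_
    refine ⟨(⋃ z ∈ c, z.1, ⋃ z ∈ c, z.2), ⟨?_, ?_, ?_, ?_⟩, fun z hz =>
      ⟨Set.subset_biUnion_of_mem (u := fun z => z.1) hz,
        Set.subset_biUnion_of_mem (u := fun z => z.2) hz⟩⟩
    · intro k hk
      obtain ⟨z, hz, hkz⟩ := Set.mem_iUnion₂.mp hk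
      exact ((hc hz).1 k hkz).trans (Set.subset_biUnion_of_mem (u := fun z => z.1) hz)
    · dsimp only
      rw [Set.biUnion_eq_iUnion]
      refine sSupIndep_iUnion_of_directed ?_ fun z => (hc z.2).2.1
      intro z w
      obtain ⟨y, hzy, hwy⟩ := hchain.directedOn.directed_val z w
      exact ⟨y, hzy.2, hwy.2⟩
    · dsimp only
      rw [Set.biUnion_eq_iUnion, Set.biUnion_eq_iUnion, sSup_iUnion, Submodule.span_iUnion]
      exact iSup_congr fun z => (hc z.2).2.2.1
    · intro K hK
      obtain ⟨z, hz, hKz⟩ := Set.mem_iUnion₂.mp hK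
      exact (hc hz).2.2.2 K hKz
  obtain ⟨⟨hS, hind, hsup, hΦ⟩, hmax⟩ := hmax
  dsimp only at hS hind hsup hΦ
  suffices hSuniv : S = Set.univ by
    refine ⟨𝒮, hind, ?_, hΦ⟩
    rw [hsup, hSuniv, Submodule.span_univ]
  by_contra hne
  obtain ⟨i, hi⟩ := (Set.ne_univ_iff_exists_notMem S).mp hne
  obtain ⟨T, hTc, hiT, hT⟩ := Set.exists_countable_mem_forall_subset supp
    (fun k => (j k).support.countable_toSet) i
  have hST : ∀ k ∈ S ∪ T, supp k ⊆ S ∪ T := by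
    rintro k (hk | hk)
    · exact (hS k hk).trans Set.subset_union_left
    · exact (hT k hk).trans Set.subset_union_right
  have hle : Submodule.span B S ≤ Submodule.span B (S ∪ T) :=
    Submodule.span_mono Set.subset_union_left
  let e : Module.End B F := ρ (S ∪ T) - ρ S * ρ (S ∪ T)
  have he_apply : ∀ x, e x = ρ (S ∪ T) x - ρ S (ρ (S ∪ T) x) := fun x => rfl
  have he_mem : ∀ x, e x ∈ Submodule.span B (S ∪ T) := fun x =>
    sub_mem (hρ_mem _ _) (hle (hρ_mem _ _))
  have hρe : ∀ x, ρ S (e x) = 0 := fun x => by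
    rw [he_apply, map_sub, hρ_eq S hS _ (hρ_mem _ _), sub_self]
  have he : e * e = e := by
    ext x
    change e (e x) = e x
    rw [he_apply (e x), hρ_eq _ hST _ (he_mem x), hρe, sub_zero]
  have heS : ∀ x ∈ Submodule.span B S, e x = 0 := fun x hx => by
    rw [he_apply, hρ_eq _ hST _ (hle hx), hρ_eq S hS _ hx, sub_self]
  have heST : ∀ x ∈ Submodule.span B (S ∪ T), x = ρ S x + e x := fun x hx => by
    rw [he_apply, hρ_eq _ hST _ hx, add_sub_cancel]
  have hrange : LinearMap.range e = Submodule.span B (e '' T) := by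
    apply le_antisymm
    · rintro _ ⟨x, rfl⟩
      have h₁ : e x ∈ (Submodule.span B (S ∪ T)).map e :=
        ⟨e x, he_mem x, LinearMap.congr_fun he x⟩
      rw [Submodule.span_union, Submodule.map_sup, Submodule.map_span e T] at h₁
      refine (sup_le ?_ le_rfl : _ ≤ Submodule.span B (e '' T)) h₁
      rintro _ ⟨y, hy, rfl⟩
      rw [heS y hy]
      exact zero_mem _
    · rw [Submodule.span_le]
      rintro _ ⟨y, -, rfl⟩
      exact ⟨y, rfl⟩
  obtain ⟨x, rfl⟩ := hTc.exists_eq_range ⟨i, hiT⟩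
  have hK : Φ (LinearMap.range e) :=
    ⟨e, he, rfl, e ∘ x, by rw [hrange, Set.range_comp]⟩
  have hdisj : Disjoint (Submodule.span B S) (LinearMap.range e) := by
    rw [Submodule.disjoint_def]
    rintro _ hy ⟨y, rfl⟩
    rw [← hρ_eq S hS _ hy, hρe]
  have hmem : (S ∪ Set.range x, insert (LinearMap.range e) 𝒮) ∈ 𝒵 := by
    refine ⟨hST, hind.insert (hsup ▸ hdisj), ?_, ?_⟩
    · dsimp only
      rw [sSup_insert, hsup]
      apply le_antisymm
      · refine sup_le ?_ hle
        rintro _ ⟨y, rfl⟩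
        exact he_mem y
      · intro y hy
        rw [heST y hy, add_comm]
        exact Submodule.add_mem_sup ⟨y, rfl⟩ (hρ_mem _ _)
    · rintro K (rfl | hKS)
      exacts [hK, hΦ K hKS]
  exact hi ((hmax hmem ⟨Set.subset_union_left, Set.subset_insert _ _⟩).1 (Or.inr hiT))

/-- Let `R` be a commutative noetherian local ring that is complete with respect
to its maximal-ideal-adic topology, and let `A` be a Noether `R`-algebra.  Then every
projective right `A`-module is a direct sum of finitely generated indecomposable projective
right `A`-modules. -/
theorem projective_isDirectSum_of_finitelyGenerated_indecomposable_projectives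
    (R : Type u) [CommRing R] [IsNoetherianRing R] [IsLocalRing R]
    [IsAdicComplete (IsLocalRing.maximalIdeal R) R]
    (A : Type u) [Ring A] [Algebra R A] [Module.Finite R A]
    (F : Type v) [AddCommGroup F] [Module Aᵐᵒᵖ F] (hF : Module.Projective Aᵐᵒᵖ F) :
    ∃ (ι : Type v) (P : ι → Submodule Aᵐᵒᵖ F),
      DirectSum.IsInternal P ∧
      ∀ i : ι, (P i).FG ∧ IsIndecomposableModule Aᵐᵒᵖ (P i) ∧
        Module.Projective Aᵐᵒᵖ (P i) := by
  have : IsNoetherianRing Aᵐᵒᵖ := IsNoetherianRing.of_finite R Aᵐᵒᵖ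
  obtain ⟨𝒦, hind, hsup, h𝒦⟩ :=
    Module.Projective.isIndepSup_countably_spanned (B := Aᵐᵒᵖ) (F := F)
  obtain ⟨𝒬, hP, hPsup, hΦ⟩ : IsIndepSup
      (fun P : Submodule Aᵐᵒᵖ F => P.FG ∧ IsIndecomposableModule Aᵐᵒᵖ P) ⊤ := by
    rw [← hsup, sSup_eq_iSup']
    refine .iSup ((sSupIndep_iff 𝒦).mp hind) fun K => ?_
    obtain ⟨e, he, hrange, x, hx⟩ := h𝒦 K K.2
    obtain ⟨𝒢, h𝒢, h𝒢sup, hfg⟩ := IsIndepSup.of_countably_spanned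
      (fun e x => exists_idempotent_fg_range_apply_eq (R := R) e.1 e.2 x) e he x (hrange.trans hx)
    rw [← hrange, ← h𝒢sup, sSup_eq_iSup']
    exact .iSup ((sSupIndep_iff 𝒢).mp h𝒢) fun N => .of_fg (hfg N N.2)
  refine ⟨𝒬, fun P => P.1, ?_, fun P => ⟨(hΦ P P.2).1, (hΦ P P.2).2, ?_⟩⟩
  · convert DirectSum.isInternal_submodule_of_iSupIndep_of_iSup_eq_top
      ((sSupIndep_iff 𝒬).mp hP) (by rw [← sSup_eq_iSup', hPsup])
  · have hcompl : IsCompl P.1 (sSup (𝒬 \ {P.1})) := by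
      refine ⟨hP P.2, codisjoint_iff.mpr ?_⟩
      rw [← sSup_insert, Set.insert_sdiff_singleton, Set.insert_eq_of_mem P.2, hPsup]
    exact Module.Projective.of_split P.1.subtype (P.1.projectionOnto _ hcompl) (by
      ext x
      simp)
end
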